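/- arXiv:1310.6482 — 6 statements merged into one kernel-verified Lean document; each statement's English description precedes it below -/
import Mathlib

section
/- Let F be a finite field of odd prime cardinality, and let P be an arc in the projective plane over F of cardinality |F| + 1. Then P is a conic: there exists a nonzero homogeneous polynomial Q of degree 2 in three variables over F such that P equals the set of projective points [v] with Q(v) = 0. -/
namespace SegreArc

theorem exists_ne_ne_of_two_lt_card {α : Type*} {S : Finset α} (hcard : 2 < S.card) {a : α}
    (ha : a ∈ S) :
    ∃ b ∈ S, ∃ c ∈ S, a ≠ b ∧ a ≠ c ∧ b ≠ c := by
  classical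
  have : 1 < (S.erase a).card := by rw [Finset.card_erase_of_mem ha]; omega
  obtain ⟨b, hb, c, hc, hbc⟩ := Finset.one_lt_card.1 this
  rw [Finset.mem_erase] at hb hc
  exact ⟨b, hb.2, c, hc.2, hb.1.symm, hc.1.symm, hbc⟩

variable {F : Type*} [Field F]

/-- The determinant of three vectors of `F³`. -/
def tripleDet (u v w : Fin 3 → F) : F :=
  u 0 * v 1 * w 2 - u 0 * v 2 * w 1 - u 1 * v 0 * w 2 + u 1 * v 2 * w 0 + u 2 * v 0 * w 1 -
    u 2 * v 1 * w 0

theorem dotProduct_eq (u v : Fin 3 → F) : u ⬝ᵥ v = u 0 * v 0 + u 1 * v 1 + u 2 * v 2 := by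
  simp [dotProduct, Fin.sum_univ_three]

theorem crossProduct_dotProduct_eq_tripleDet (u v w : Fin 3 → F) :
    crossProduct u v ⬝ᵥ w = tripleDet u v w := by
  rw [dotProduct_eq]
  simp [cross_apply, tripleDet]
  ring

theorem tripleDet_ne_zero_of_linearIndependent {u v w : Fin 3 → F}
    (h : LinearIndependent F ![u, v, w]) : tripleDet u v w ≠ 0 := by
  have := (Matrix.linearIndependent_rows_iff_isUnit (A := Matrix.of ![u, v, w])).1 h
  rw [Matrix.isUnit_iff_isUnit_det, isUnit_iff_ne_zero, Matrix.det_fin_three] at this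
  simpa [tripleDet] using this

theorem tripleDet_swap (u v w : Fin 3 → F) : tripleDet u v w = -tripleDet v u w := by
  simp only [tripleDet]; ring

/-- Cramer's rule in dimension three. -/
theorem tripleDet_smul_eq (a b c x : Fin 3 → F) :
    tripleDet a b c • x =
      tripleDet b c x • a + tripleDet c a x • b + tripleDet a b x • c := by
  ext i
  fin_cases i <;> simp [tripleDet] <;> ring

theorem tripleDet_mul_dotProduct (a b c x u : Fin 3 → F) :
    tripleDet a b c * (u ⬝ᵥ x) =
      tripleDet b c x * (u ⬝ᵥ a) + tripleDet c a x * (u ⬝ᵥ b) + tripleDet a b x * (u ⬝ᵥ c) := by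
  simpa using congrArg (u ⬝ᵥ ·) (tripleDet_smul_eq a b c x)

theorem tripleDet_plucker (a b c x y : Fin 3 → F) :
    tripleDet a c x * tripleDet a b y - tripleDet a c y * tripleDet a b x =
      -(tripleDet a b c * tripleDet a x y) := by
  simp only [tripleDet]; ring

/-- The linear form with coefficient vector `v`. -/
noncomputable def linearForm (v : Fin 3 → F) : MvPolynomial (Fin 3) F :=
  ∑ i, MvPolynomial.C (v i) * MvPolynomial.X i

theorem eval_linearForm (v x : Fin 3 → F) : MvPolynomial.eval x (linearForm v) = v ⬝ᵥ x := by
  simp [linearForm, dotProduct]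

theorem isHomogeneous_linearForm (v : Fin 3 → F) : (linearForm v).IsHomogeneous 1 :=
  MvPolynomial.IsHomogeneous.sum _ _ _ fun i _ => MvPolynomial.isHomogeneous_C_mul_X (v i) i

theorem tripleDet_mul_tripleDet (a b c u v x : Fin 3 → F) :
    tripleDet a b c * tripleDet u v x =
      tripleDet b c x * tripleDet u v a + tripleDet c a x * tripleDet u v b +
        tripleDet a b x * tripleDet u v c := by
  simpa only [crossProduct_dotProduct_eq_tripleDet] using
    tripleDet_mul_dotProduct a b c x (crossProduct u v)

/-- A finite set of vectors of `F³`, any three of which are linearly independent. -/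
def IsVectorArc (S : Finset (Fin 3 → F)) : Prop :=
  ∀ a ∈ S, ∀ b ∈ S, ∀ c ∈ S, a ≠ b → a ≠ c → b ≠ c → tripleDet a b c ≠ 0

/-- The linear form `u ⬝ᵥ ·` vanishes at `a` and at no other point of `S`. -/
def IsTangent (S : Finset (Fin 3 → F)) (a u : Fin 3 → F) : Prop :=
  u ⬝ᵥ a = 0 ∧ ∀ p ∈ S, p ≠ a → u ⬝ᵥ p ≠ 0

variable {S : Finset (Fin 3 → F)}

theorem IsTangent.smul {a u : Fin 3 → F} (hu : IsTangent S a u) {k : F} (hk : k ≠ 0) :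
    IsTangent S a (k • u) := by
  refine ⟨by simp [hu.1], fun p hp hpa => ?_⟩
  simpa [hk] using hu.2 p hp hpa

/-- The slopes of the lines joining `a` to the points of an arc are pairwise distinct. -/
theorem IsVectorArc.slope_injOn (hS : IsVectorArc S) {a b c : Fin 3 → F} (ha : a ∈ S) (hb : b ∈ S)
    (hc : c ∈ S) (hab : a ≠ b) (hac : a ≠ c) (hbc : b ≠ c) [DecidableEq F] :
    Set.InjOn (fun p => tripleDet a c p / tripleDet a b p) ((S.erase a).erase b) := by
  intro x hx y hy hxy
  simp only [Finset.coe_erase, Set.mem_sdiff, Set.mem_singleton_iff, Finset.mem_coe] at hx hy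
  by_contra hne
  have h1 := hS a ha b hb x hx.1.1 hab (Ne.symm hx.1.2) (Ne.symm hx.2)
  have h2 := hS a ha b hb y hy.1.1 hab (Ne.symm hy.1.2) (Ne.symm hy.2)
  have h3 := hS a ha x hx.1.1 y hy.1.1 (Ne.symm hx.1.2) (Ne.symm hy.1.2) hne
  have h4 := hS a ha b hb c hc hab hac hbc
  simp only [div_eq_div_iff h1 h2] at hxy
  have := tripleDet_plucker a b c x y
  rw [hxy, sub_self, zero_eq_neg] at this
  exact mul_ne_zero h4 h3 this

variable [Fintype F]

/-- A slope missed by an arc of size `q + 1` is the only one. -/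
theorem IsVectorArc.image_slope (hS : IsVectorArc S) (hcard : S.card = Fintype.card F + 1)
    {a b c : Fin 3 → F} (ha : a ∈ S) (hb : b ∈ S) (hc : c ∈ S) (hab : a ≠ b) (hac : a ≠ c)
    (hbc : b ≠ c) [DecidableEq F] {k : F}
    (hk : ∀ p ∈ (S.erase a).erase b, tripleDet a c p / tripleDet a b p ≠ k) :
    ((S.erase a).erase b).image (fun p => tripleDet a c p / tripleDet a b p) =
      Finset.univ.erase k := by
  apply Finset.eq_of_subset_of_card_le
  · intro y hy
    obtain ⟨p, hp, rfl⟩ := Finset.mem_image.1 hy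
    simpa using hk p hp
  · rw [Finset.card_image_of_injOn (hS.slope_injOn ha hb hc hab hac hbc),
      Finset.card_erase_of_mem (Finset.mem_erase.2 ⟨hab.symm, hb⟩), Finset.card_erase_of_mem ha,
      Finset.card_erase_of_mem (Finset.mem_univ k), hcard, Finset.card_univ, Nat.add_sub_cancel]

/-- An arc of size `q + 1` has a tangent at each of its points, and every other line through the
point meets the arc again. -/
theorem IsVectorArc.exists_isTangent (hS : IsVectorArc S) (hcard : S.card = Fintype.card F + 1)
    {a : Fin 3 → F} (ha : a ∈ S) :
    ∃ u, IsTangent S a u ∧ ∀ x, u ⬝ᵥ x ≠ 0 → ∃ p ∈ S, p ≠ a ∧ tripleDet a p x = 0 := by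
  classical
  have hq : 1 < Fintype.card F := Fintype.one_lt_card
  obtain ⟨b, hb, c, hc, hab, hac, hbc⟩ := exists_ne_ne_of_two_lt_card (by omega) ha
  have hlt : (((S.erase a).erase b).image
      (fun p => tripleDet a c p / tripleDet a b p)).card < (Finset.univ : Finset F).card := by
    refine Finset.card_image_le.trans_lt ?_
    rw [Finset.card_erase_of_mem (by simp [hb, Ne.symm hab]), Finset.card_erase_of_mem ha,
      hcard, Finset.card_univ]
    omega
  obtain ⟨k, -, hk⟩ := Finset.exists_mem_notMem_of_card_lt_card hlt
  simp only [Finset.mem_image, not_exists, not_and] at hk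
  have him := hS.image_slope hcard ha hb hc hab hac hbc hk
  have hdot (x : Fin 3 → F) : (crossProduct a c - k • crossProduct a b) ⬝ᵥ x =
      tripleDet a c x - k * tripleDet a b x := by
    simp [sub_dotProduct, crossProduct_dotProduct_eq_tripleDet]
  refine ⟨crossProduct a c - k • crossProduct a b, ⟨?_, fun p hp hpa => ?_⟩, fun x hx => ?_⟩
  · rw [hdot]; simp only [tripleDet]; ring
  · rw [hdot]
    by_cases hpb : p = b
    · subst hpb
      have h0 : tripleDet a p p = 0 := by simp only [tripleDet]; ring
      rw [h0, mul_zero, sub_zero]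
      exact hS a ha c hc p hb hac hab hbc.symm
    · intro h
      refine hk p (by simp [hp, hpa, hpb]) ?_
      rw [div_eq_iff (hS a ha b hb p hp hab (Ne.symm hpa) (Ne.symm hpb))]
      exact sub_eq_zero.1 h
  · rw [hdot] at hx
    by_cases h0 : tripleDet a b x = 0
    · exact ⟨b, hb, hab.symm, h0⟩
    · have hmem : tripleDet a c x / tripleDet a b x ∈ Finset.univ.erase k := by
        simp only [Finset.mem_erase, Finset.mem_univ, and_true]
        rw [Ne, div_eq_iff h0]
        exact fun h => hx (sub_eq_zero.2 h)
      rw [← him] at hmem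
      obtain ⟨p, hp, hpx⟩ := Finset.mem_image.1 hmem
      simp only [Finset.mem_erase] at hp
      refine ⟨p, hp.2.2, hp.2.1, ?_⟩
      rw [div_eq_div_iff (hS a ha b hb p hp.2.2 hab (Ne.symm hp.2.1) (Ne.symm hp.1)) h0] at hpx
      have := tripleDet_plucker a b c p x
      rw [hpx, sub_self, zero_eq_neg] at this
      exact (mul_eq_zero.1 this).resolve_left (hS a ha b hb c hc hab hac hbc)

theorem prod_univ_erase_zero [DecidableEq F] : ∏ x ∈ (Finset.univ : Finset F).erase 0, x = -1 := by
  have h := congrArg (Units.val (α := F)) (FiniteField.prod_univ_units_id_eq_neg_one (K := F))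
  rw [Units.coe_prod, Units.val_neg, Units.val_one] at h
  rw [← h]
  symm
  refine Finset.prod_bij (fun x _ => (x : F)) (by simp) (fun x _ y _ h => Units.ext h)
    (fun x hx => ⟨Units.mk0 x (by simpa using hx), by simp, rfl⟩) (by simp)

/-- Wilson's theorem applied to the slopes of the lines joining `a` to the points of an arc. -/
theorem IsVectorArc.prod_slope (hS : IsVectorArc S) (hcard : S.card = Fintype.card F + 1)
    {a b c u : Fin 3 → F} (ha : a ∈ S) (hb : b ∈ S) (hc : c ∈ S) (hab : a ≠ b) (hac : a ≠ c)
    (hbc : b ≠ c) [DecidableEq F] (hu : IsTangent S a u) :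
    (u ⬝ᵥ c) * ∏ p ∈ S \ {a, b, c}, tripleDet a c p =
      -((u ⬝ᵥ b) * ∏ p ∈ S \ {a, b, c}, tripleDet a b p) := by
  have hub : u ⬝ᵥ b ≠ 0 := hu.2 b hb hab.symm
  have huc : u ⬝ᵥ c ≠ 0 := hu.2 c hc hac.symm
  have habc := hS a ha b hb c hc hab hac hbc
  have hacc : tripleDet a c c = 0 := by simp only [tripleDet]; ring
  have hk : ∀ p ∈ (S.erase a).erase b,
      tripleDet a c p / tripleDet a b p ≠ (u ⬝ᵥ c) / (u ⬝ᵥ b) := by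
    intro p hp h
    simp only [Finset.mem_erase] at hp
    rw [div_eq_div_iff (hS a ha b hb p hp.2.2 hab (Ne.symm hp.2.1) (Ne.symm hp.1)) hub] at h
    have key := tripleDet_mul_dotProduct a b c p u
    have hca : tripleDet c a p = -tripleDet a c p := tripleDet_swap c a p
    rw [hu.1, hca] at key
    have : tripleDet a b c * (u ⬝ᵥ p) = 0 := by linear_combination key - h
    exact mul_ne_zero habc (hu.2 p hp.2.2 hp.2.1) this
  have him := hS.image_slope hcard ha hb hc hab hac hbc hk
  have hSc : S \ {a, b, c} = ((S.erase a).erase b).erase c := by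
    ext p; simp; tauto
  have himc : (S \ {a, b, c}).image (fun p => tripleDet a c p / tripleDet a b p) =
      (Finset.univ.erase 0).erase ((u ⬝ᵥ c) / (u ⬝ᵥ b)) := by
    rw [Finset.erase_right_comm, ← him, hSc]
    have hcm : c ∈ (S.erase a).erase b := by simp [hc, hac.symm, hbc.symm]
    ext y
    simp only [Finset.mem_image, Finset.mem_erase (a := y)]
    constructor
    · rintro ⟨p, hp, rfl⟩
      obtain ⟨hpc, hp⟩ := Finset.mem_erase.1 hp
      refine ⟨fun h0 => hpc ?_, p, hp, rfl⟩
      exact hS.slope_injOn ha hb hc hab hac hbc hp hcm (by simpa [hacc] using h0)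
    · rintro ⟨h0, p, hp, rfl⟩
      refine ⟨p, Finset.mem_erase.2 ⟨?_, hp⟩, rfl⟩
      rintro rfl
      simp [hacc] at h0
  have hprod : (u ⬝ᵥ c) / (u ⬝ᵥ b) *
      ∏ p ∈ S \ {a, b, c}, tripleDet a c p / tripleDet a b p = -1 := by
    rw [← prod_univ_erase_zero, ← Finset.mul_prod_erase _ _
      (show (u ⬝ᵥ c) / (u ⬝ᵥ b) ∈ Finset.univ.erase 0 by simp [hub, huc]), ← himc,
      Finset.prod_image]
    refine (hS.slope_injOn ha hb hc hab hac hbc).mono ?_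
    rw [hSc]
    exact Finset.coe_subset.2 (Finset.erase_subset _ _)
  have hne : ∏ p ∈ S \ {a, b, c}, tripleDet a b p ≠ 0 := by
    refine Finset.prod_ne_zero_iff.2 fun p hp => ?_
    simp only [Finset.mem_sdiff, Finset.mem_insert, Finset.mem_singleton, not_or] at hp
    exact hS a ha b hb p hp.1 hab (Ne.symm hp.2.1) (Ne.symm hp.2.2.1)
  rw [Finset.prod_div_distrib] at hprod
  field_simp at hprod
  linear_combination hprod

/-- **Segre's lemma of tangents**. -/
theorem IsVectorArc.lemma_of_tangents (hS : IsVectorArc S) (hcard : S.card = Fintype.card F + 1)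
    (hodd : Odd (Fintype.card F)) {a b c u v w : Fin 3 → F} (ha : a ∈ S) (hb : b ∈ S) (hc : c ∈ S)
    (hab : a ≠ b) (hac : a ≠ c) (hbc : b ≠ c) (hu : IsTangent S a u) (hv : IsTangent S b v)
    (hw : IsTangent S c w) :
    (u ⬝ᵥ b) * (v ⬝ᵥ c) * (w ⬝ᵥ a) = (u ⬝ᵥ c) * (v ⬝ᵥ a) * (w ⬝ᵥ b) := by
  classical
  have hbca : ({b, c, a} : Finset (Fin 3 → F)) = {a, b, c} := by ext; simp; tauto
  have hcab : ({c, a, b} : Finset (Fin 3 → F)) = {a, b, c} := by ext; simp; tauto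
  have h1 := hS.prod_slope hcard ha hb hc hab hac hbc hu
  have h2 := hS.prod_slope hcard hb hc ha hbc hab.symm hac.symm hv
  have h3 := hS.prod_slope hcard hc ha hb hac.symm hbc.symm hab hw
  rw [hbca] at h2
  rw [hcab] at h3
  have hoddT : Odd (S \ {a, b, c}).card := by
    rw [Finset.card_sdiff_of_subset (by simp [Finset.insert_subset_iff, ha, hb, hc]), hcard,
      Finset.card_eq_three.2 ⟨a, b, c, hab, hac, hbc, rfl⟩]
    have : 1 < Fintype.card F := Fintype.one_lt_card
    obtain ⟨m, hm⟩ := hodd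
    exact ⟨m - 1, by omega⟩
  have hswap (x y : Fin 3 → F) : ∏ p ∈ S \ {a, b, c}, tripleDet x y p =
      -∏ p ∈ S \ {a, b, c}, tripleDet y x p := by
    rw [Finset.prod_congr rfl fun p _ => tripleDet_swap x y p, Finset.prod_neg, hoddT.neg_one_pow]
    ring
  have hne {x y : Fin 3 → F} (hx : x ∈ S) (hy : y ∈ S) (hxy : x ≠ y)
      (hx' : x ∈ ({a, b, c} : Finset (Fin 3 → F))) (hy' : y ∈ ({a, b, c} : Finset (Fin 3 → F))) :
      ∏ p ∈ S \ {a, b, c}, tripleDet x y p ≠ 0 := by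
    refine Finset.prod_ne_zero_iff.2 fun p hp => ?_
    rw [Finset.mem_sdiff] at hp
    exact hS x hx y hy p hp.1 hxy (by rintro rfl; exact hp.2 hx') (by rintro rfl; exact hp.2 hy')
  have n1 := hne ha hb hab (by simp) (by simp)
  have n2 := hne hb hc hbc (by simp) (by simp)
  have n3 := hne hc ha hac.symm (by simp) (by simp)
  rw [hswap a c] at h1
  rw [hswap b a] at h2
  rw [hswap c b] at h3
  have e := congrArg₂ (· * ·) (congrArg₂ (· * ·) h1 h2) h3
  refine mul_right_cancel₀ (mul_ne_zero (mul_ne_zero n1 n2) n3) ?_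
  linear_combination e

/-- The tangents of an arc of size `q + 1` can be scaled so that they become symmetric. -/
theorem IsVectorArc.exists_symmetric_tangents (hS : IsVectorArc S)
    (hcard : S.card = Fintype.card F + 1) (hodd : Odd (Fintype.card F)) :
    ∃ t : (Fin 3 → F) → (Fin 3 → F), (∀ a ∈ S, IsTangent S a (t a)) ∧
      (∀ a ∈ S, ∀ x, t a ⬝ᵥ x ≠ 0 → ∃ p ∈ S, p ≠ a ∧ tripleDet a p x = 0) ∧
      ∀ a ∈ S, ∀ b ∈ S, t a ⬝ᵥ b = t b ⬝ᵥ a := by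
  classical
  choose! t ht hmeet using fun a (ha : a ∈ S) => hS.exists_isTangent hcard ha
  obtain ⟨o, ho⟩ : S.Nonempty := Finset.card_pos.1 (by omega)
  let k (p : Fin 3 → F) : F := if p = o then 1 else (t o ⬝ᵥ p) / (t p ⬝ᵥ o)
  have hk {p : Fin 3 → F} (hp : p ∈ S) : k p ≠ 0 := by
    simp only [k]
    split_ifs with h
    · exact one_ne_zero
    · exact div_ne_zero ((ht o ho).2 p hp h) ((ht p hp).2 o ho (Ne.symm h))
  have htk (a : Fin 3 → F) (ha : a ∈ S) : IsTangent S a (k a • t a) := (ht a ha).smul (hk ha)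
  have hsymo (p : Fin 3 → F) (hp : p ∈ S) : (k p • t p) ⬝ᵥ o = (k o • t o) ⬝ᵥ p := by
    by_cases h : p = o
    · rw [h]
    · have := (ht p hp).2 o ho (Ne.symm h)
      simp [k, h, this]
  refine ⟨fun p => k p • t p, htk, fun a ha x hx => hmeet a ha x fun h => hx (by simp [h]),
    fun a ha b hb => ?_⟩
  by_cases hab : a = b
  · rw [hab]
  by_cases hao : a = o
  · rw [hao]; exact (hsymo b hb).symm
  by_cases hbo : b = o
  · rw [hbo]; exact hsymo a ha
  have h := hS.lemma_of_tangents hcard hodd ho ha hb (Ne.symm hao) (Ne.symm hbo) hab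
    (htk o ho) (htk a ha) (htk b hb)
  rw [hsymo a ha, hsymo b hb] at h
  refine mul_left_cancel₀ (mul_ne_zero ((htk o ho).2 a ha hao) ((htk o ho).2 b hb hbo)) ?_
  linear_combination h


/-- An arc of size `q + 1`, given by vectors, is the zero locus of a quadratic form. -/
theorem IsVectorArc.exists_quadraticForm (hS : IsVectorArc S)
    (hcard : S.card = Fintype.card F + 1) (hodd : Odd (Fintype.card F)) :
    ∃ Q : MvPolynomial (Fin 3) F, Q ≠ 0 ∧ Q.IsHomogeneous 2 ∧
      (∀ p ∈ S, MvPolynomial.eval p Q = 0) ∧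
      ∀ x, MvPolynomial.eval x Q = 0 → x ≠ 0 → ∃ p ∈ S, ∃ k : F, x = k • p := by
  have h2 : (2 : F) ≠ 0 := Ring.two_ne_zero fun h => by
    have := FiniteField.even_card_of_char_two h
    have := Nat.odd_iff.1 hodd
    omega
  have hS2 : 2 < S.card := by
    have : 1 < Fintype.card F := Fintype.one_lt_card
    omega
  obtain ⟨t, ht, hmeet, hsymm⟩ := hS.exists_symmetric_tangents hcard hodd
  obtain ⟨a, ha⟩ : S.Nonempty := Finset.card_pos.1 (by omega)
  obtain ⟨b, hb, c, hc, hab, hac, hbc⟩ := exists_ne_ne_of_two_lt_card hS2 ha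
  have hΔ := hS a ha b hb c hc hab hac hbc
  let B (x y : Fin 3 → F) : F := tripleDet b c x * (t a ⬝ᵥ y) + tripleDet c a x * (t b ⬝ᵥ y) +
    tripleDet a b x * (t c ⬝ᵥ y)
  have hta := (ht a ha).1
  have htb := (ht b hb).1
  have htc := (ht c hc).1
  have hba := hsymm b hb a ha
  have hca := hsymm c hc a ha
  have hcb := hsymm c hc b hb
  have hta' (x : Fin 3 → F) := tripleDet_mul_dotProduct a b c x (t a)
  have htb' (x : Fin 3 → F) := tripleDet_mul_dotProduct a b c x (t b)
  have htc' (x : Fin 3 → F) := tripleDet_mul_dotProduct a b c x (t c)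
  simp only [hta, htb, htc, hba, hca, hcb] at hta' htb' htc'
  have hBsymm (x y : Fin 3 → F) : B x y = B y x := by
    refine mul_left_cancel₀ hΔ ?_
    simp only [B]
    linear_combination tripleDet b c x * hta' y + tripleDet c a x * htb' y +
      tripleDet a b x * htc' y - tripleDet b c y * hta' x - tripleDet c a y * htb' x -
      tripleDet a b y * htc' x
  have hBt (p : Fin 3 → F) (hp : p ∈ S) (y : Fin 3 → F) :
      B p y = tripleDet a b c * (t p ⬝ᵥ y) := by
    rw [hBsymm, tripleDet_mul_dotProduct a b c y (t p), hsymm p hp a ha, hsymm p hp b hb,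
      hsymm p hp c hc]
  let Q : MvPolynomial (Fin 3) F := linearForm (crossProduct b c) * linearForm (t a) +
    linearForm (crossProduct c a) * linearForm (t b) +
    linearForm (crossProduct a b) * linearForm (t c)
  have hQ (x : Fin 3 → F) : MvPolynomial.eval x Q = B x x := by
    simp only [Q, B, map_add, map_mul, eval_linearForm, crossProduct_dotProduct_eq_tripleDet]
  have hBadd (x y z : Fin 3 → F) : B x (y + z) = B x y + B x z := by
    simp only [B, dotProduct_add]; ring
  refine ⟨Q, fun h0 => ?_, ?_, fun p hp => ?_, fun x hx hx0 => ?_⟩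
  · have h := hQ (a + b)
    rw [h0, map_zero, hBadd, hBsymm, hBsymm _ b, hBt a ha, hBt b hb, dotProduct_add,
      dotProduct_add, hta, htb, hba] at h
    have : 2 * (tripleDet a b c * (t a ⬝ᵥ b)) = 0 := by linear_combination -h
    exact mul_ne_zero h2 (mul_ne_zero hΔ ((ht a ha).2 b hb hab.symm)) this
  · have hmul (u v : Fin 3 → F) : (linearForm u * linearForm v).IsHomogeneous 2 :=
      (isHomogeneous_linearForm u).mul (isHomogeneous_linearForm v)
    exact ((hmul _ _).add (hmul _ _)).add (hmul _ _)
  · rw [hQ, hBt p hp, (ht p hp).1, mul_zero]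
  · obtain ⟨p, hp, hpx⟩ : ∃ p ∈ S, t p ⬝ᵥ x ≠ 0 := by
      by_contra! hall
      have ea := hta' x
      have eb := htb' x
      have ec := htc' x
      rw [hall a ha] at ea
      rw [hall b hb] at eb
      rw [hall c hc] at ec
      have nab := (ht a ha).2 b hb hab.symm
      have nac := (ht a ha).2 c hc hac.symm
      have nbc := (ht b hb).2 c hc hbc.symm
      have za : tripleDet b c x = 0 := by
        refine (mul_eq_zero.1 (?_ : (2 * (t a ⬝ᵥ b) * (t a ⬝ᵥ c)) * _ = 0)).resolve_left
          (mul_ne_zero (mul_ne_zero h2 nab) nac)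
        linear_combination (t b ⬝ᵥ c) * ea - (t a ⬝ᵥ c) * eb - (t a ⬝ᵥ b) * ec
      have zb : tripleDet c a x = 0 := by simpa [za, nbc] using ec
      have zc : tripleDet a b x = 0 := by simpa [za, nbc] using eb
      have := tripleDet_smul_eq a b c x
      rw [za, zb, zc] at this
      simp [hΔ, hx0] at this
    obtain ⟨r, hr, hrp, hprx⟩ := hmeet p hp x hpx
    obtain ⟨s, hs, hps, hrs⟩ : ∃ s ∈ S, p ≠ s ∧ r ≠ s := by
      classical
      obtain ⟨s, hs, hs'⟩ := Finset.exists_mem_notMem_of_card_lt_card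
        ((Finset.card_le_two (a := p) (b := r)).trans_lt hS2)
      simp only [Finset.mem_insert, Finset.mem_singleton, not_or] at hs'
      exact ⟨s, hs, Ne.symm hs'.1, Ne.symm hs'.2⟩
    have hprs := hS p hp r hr s hs hrp.symm hps hrs
    have hxpr := tripleDet_smul_eq p r s x
    rw [hprx, zero_smul, add_zero] at hxpr
    have hBx : tripleDet p r s * B x x =
        tripleDet r s x * B p x + tripleDet s p x * B r x := by
      simp only [B]
      have e1 := tripleDet_mul_tripleDet p r s b c x
      have e2 := tripleDet_mul_tripleDet p r s c a x
      have e3 := tripleDet_mul_tripleDet p r s a b x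
      rw [hprx] at e1 e2 e3
      linear_combination (t a ⬝ᵥ x) * e1 + (t b ⬝ᵥ x) * e2 + (t c ⬝ᵥ x) * e3
    rw [← hQ, hx, hBt p hp, hBt r hr] at hBx
    have ep := tripleDet_mul_dotProduct p r s x (t p)
    have er := tripleDet_mul_dotProduct p r s x (t r)
    rw [hprx, (ht p hp).1] at ep
    rw [hprx, (ht r hr).1, hsymm r hr p hp] at er
    have hprod : (2 * tripleDet a b c * (t p ⬝ᵥ r)) * (tripleDet r s x * tripleDet s p x) = 0 := by
      linear_combination -tripleDet p r s * hBx - tripleDet a b c * tripleDet r s x * ep -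
        tripleDet a b c * tripleDet s p x * er
    have hscale {y : Fin 3 → F} {k : F} (h : tripleDet p r s • x = k • y) :
        x = ((tripleDet p r s)⁻¹ * k) • y := by
      rw [mul_smul, ← h, smul_smul, inv_mul_cancel₀ hprs, one_smul]
    rcases mul_eq_zero.1 ((mul_eq_zero.1 hprod).resolve_left
      (mul_ne_zero (mul_ne_zero h2 hΔ) ((ht p hp).2 r hr hrp))) with h | h
    · rw [h, zero_smul, zero_add] at hxpr
      exact ⟨r, hr, _, hscale hxpr⟩
    · rw [h, zero_smul, add_zero] at hxpr
      exact ⟨p, hp, _, hscale hxpr⟩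

end SegreArc


/-- **Segre's theorem** (Theorem 1.9). -/
theorem segre (F : Type*) [Field F] [Fintype F]
    (hprime : (Fintype.card F).Prime) (hodd : Odd (Fintype.card F))
    (A : Set (Projectivization F (Fin 3 → F)))
    (hcard : A.ncard = Fintype.card F + 1)
    (harc : ∀ a ∈ A, ∀ b ∈ A, ∀ c ∈ A, a ≠ b → a ≠ c → b ≠ c →
      LinearIndependent F ![a.rep, b.rep, c.rep]) :
    ∃ Q : MvPolynomial (Fin 3) F, Q ≠ 0 ∧ Q.IsHomogeneous 2 ∧
      A = {x | MvPolynomial.eval x.rep Q = 0} := by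
  classical
  have hinj : Function.Injective (Projectivization.rep (K := F) (V := Fin 3 → F)) :=
    fun x y h => by
      rw [← x.mk_rep, ← y.mk_rep, Projectivization.mk_eq_mk_iff']
      exact ⟨1, by rw [one_smul, h]⟩
  have hfin : A.Finite := Set.finite_of_ncard_pos (by omega)
  let S : Finset (Fin 3 → F) := hfin.toFinset.image Projectivization.rep
  have hScard : S.card = Fintype.card F + 1 := by
    rw [Finset.card_image_of_injective _ hinj, ← Set.ncard_eq_toFinset_card A hfin, hcard]
  have hmem {v : Fin 3 → F} : v ∈ S ↔ ∃ x ∈ A, x.rep = v := by simp [S]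
  have hS : SegreArc.IsVectorArc S := by
    intro u hu v hv w hw huv huw hvw
    obtain ⟨a, ha, rfl⟩ := hmem.1 hu
    obtain ⟨b, hb, rfl⟩ := hmem.1 hv
    obtain ⟨c, hc, rfl⟩ := hmem.1 hw
    exact SegreArc.tripleDet_ne_zero_of_linearIndependent
      (harc a ha b hb c hc (ne_of_apply_ne _ huv) (ne_of_apply_ne _ huw) (ne_of_apply_ne _ hvw))
  obtain ⟨Q, hQ0, hQ, hSQ, hQS⟩ := hS.exists_quadraticForm hScard hodd
  refine ⟨Q, hQ0, hQ, Set.ext fun x => ⟨fun hx => hSQ _ (hmem.2 ⟨x, hx, rfl⟩), fun hx => ?_⟩⟩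
  obtain ⟨p, hp, k, hk⟩ := hQS x.rep hx x.rep_nonzero
  obtain ⟨y, hy, rfl⟩ := hmem.1 hp
  have hxy : x = y := by
    rw [← x.mk_rep, ← y.mk_rep, Projectivization.mk_eq_mk_iff']
    exact ⟨k, hk.symm⟩
  exact hxy ▸ hy
end

section
/- Let F be a finite field, let n ≥ 1 and d ≥ 0 be integers, and let P ∈ F[x₁,…,xₙ] be a non-zero polynomial of total degree at most d. Then the sum over all points p ∈ Fⁿ of ord_p(P) is at most d·|F|^(n−1). -/
/-- The order of vanishing of a multivariate polynomial `P` at a point `p`: the largest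
`m` such that `P` lies in the `m`-th power of the maximal ideal at `p` (generated by the
`Xᵢ - pᵢ`). -/
noncomputable def vanishingOrder {F : Type*} [Field F] {n : ℕ}
    (P : MvPolynomial (Fin n) F) (p : Fin n → F) : ℕ :=
  sSup {m : ℕ |
    P ∈ (Ideal.span (Set.range fun i => MvPolynomial.X i - MvPolynomial.C (p i))) ^ m}

open MvPolynomial in
/-- Translation of the variables, `Xᵢ ↦ Xᵢ + aᵢ`, which moves the point `a` to the origin. -/
noncomputable def MvPolynomial.translate {σ R : Type*} [CommRing R] (a : σ → R) :
    MvPolynomial σ R →ₐ[R] MvPolynomial σ R :=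
  aeval fun i => X i + C (a i)

namespace MvPolynomial

section Translate

variable {σ R : Type*} [CommRing R]

@[simp]
theorem translate_X (a : σ → R) (i : σ) : translate a (X i) = X i + C (a i) := by
  simp [translate]

theorem translate_neg_translate (a : σ → R) (P : MvPolynomial σ R) :
    translate (-a) (translate a P) = P := by
  have : (translate (-a)).comp (translate a) = AlgHom.id R _ := by
    ext i : 1
    simp
  exact DFunLike.congr_fun this P

theorem translate_ne_zero (a : σ → R) {P : MvPolynomial σ R} (hP : P ≠ 0) :
    translate a P ≠ 0 := by
  intro h
  apply hP
  rw [← translate_neg_translate a P, h, map_zero]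

theorem mem_span_X_sub_C_pow_iff (a : σ → R) (m : ℕ) (P : MvPolynomial σ R) :
    P ∈ Ideal.span (Set.range fun i => X i - C (a i)) ^ m ↔
      ∀ e : σ →₀ ℕ, e.degree < m → coeff e (translate a P) = 0 := by
  rw [← mem_pow_idealOfVars_iff']
  constructor
  · intro h
    have := Ideal.mem_map_of_mem (translate a) h
    rw [Ideal.map_pow, Ideal.map_span, ← Set.range_comp] at this
    simpa [Function.comp_def, idealOfVars] using this
  · intro h
    have := Ideal.mem_map_of_mem (translate (-a)) h
    rw [translate_neg_translate, Ideal.map_pow, idealOfVars, Ideal.map_span,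
      ← Set.range_comp] at this
    simpa [Function.comp_def, sub_eq_add_neg] using this

end Translate

theorem pow_dvd_coeff_of_mem_pow {σ R : Type*} [CommRing R] {z : R}
    {I : Ideal (MvPolynomial σ R)} (hI : ∀ g ∈ I, z ∣ coeff 0 g) {m : ℕ}
    {g : MvPolynomial σ R} (hg : g ∈ I ^ m) (e : σ →₀ ℕ) :
    z ^ (m - e.degree) ∣ coeff e g := by
  classical
  induction m generalizing g e with
  | zero => simp
  | succ m ih =>
    rw [pow_succ] at hg
    induction hg using Submodule.mul_induction_on' with
    | mem_mul_mem u hu v hv =>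
      rw [coeff_mul]
      refine Finset.dvd_sum fun x hx => ?_
      obtain rfl := Finset.HasAntidiagonal.mem_antidiagonal.1 hx
      rw [map_add]
      by_cases hx0 : x.2 = 0
      · rw [hx0, map_zero, add_zero]
        refine (pow_dvd_pow z (n := m - x.1.degree + 1) (by omega)).trans ?_
        rw [pow_succ]
        exact mul_dvd_mul (ih hu x.1) (hI v hv)
      · have : x.2.degree ≠ 0 := by rwa [ne_eq, Finsupp.degree_eq_zero_iff]
        exact ((pow_dvd_pow z (by omega)).trans (ih hu x.1)).mul_right _
    | add u _ v _ hu hv =>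
      rw [coeff_add]
      exact dvd_add hu hv

section Slice

variable {n : ℕ} {R : Type*} [CommRing R]

/-- Translation of all the variables but the first by `a`, with the first variable regarded as
the variable of the coefficient ring. -/
noncomputable def sliceHom (a : Fin n → R) :
    MvPolynomial (Fin (n + 1)) R →+* MvPolynomial (Fin n) (Polynomial R) :=
  (Polynomial.eval₂RingHom ((map Polynomial.C).comp (translate a : _ →+* _))
    (C Polynomial.X)).comp (finSuccEquiv R n).toRingEquiv.toRingHom

theorem sliceHom_apply (a : Fin n → R) (P : MvPolynomial (Fin (n + 1)) R) :
    sliceHom a P = (finSuccEquiv R n P).eval₂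
      ((map Polynomial.C).comp (translate a : _ →+* _)) (C Polynomial.X) :=
  rfl

theorem coeff_coeff_sliceHom (a : Fin n → R) (P : MvPolynomial (Fin (n + 1)) R)
    (e : Fin n →₀ ℕ) (j : ℕ) :
    (coeff e (sliceHom a P)).coeff j = coeff e (translate a ((finSuccEquiv R n P).coeff j)) := by
  rw [sliceHom_apply]
  induction finSuccEquiv R n P using Polynomial.induction_on' with
  | add p q hp hq => simp [Polynomial.eval₂_add, hp, hq]
  | monomial k r =>
    rw [Polynomial.eval₂_monomial, ← C_pow, mul_comm, coeff_C_mul]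
    simp only [RingHom.comp_apply, RingHom.coe_coe, coeff_map]
    rw [mul_comm, Polynomial.coeff_C_mul_X_pow, Polynomial.coeff_monomial]
    split_ifs <;> simp_all

theorem pow_dvd_coeff_sliceHom (b : R) (a : Fin n → R) {m : ℕ}
    {P : MvPolynomial (Fin (n + 1)) R}
    (hP : P ∈ Ideal.span (Set.range fun i =>
      X i - C ((Fin.cons b a : Fin (n + 1) → R) i)) ^ m)
    (e : Fin n →₀ ℕ) :
    (Polynomial.X - Polynomial.C b) ^ (m - e.degree) ∣ coeff e (sliceHom a P) := by
  have h := Ideal.mem_map_of_mem (sliceHom a) hP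
  rw [Ideal.map_pow] at h
  refine pow_dvd_coeff_of_mem_pow (fun g hg => ?_) h e
  rw [← constantCoeff_eq, ← Ideal.mem_span_singleton, ← Ideal.mem_comap]
  refine (?_ : Ideal.map (sliceHom a) _ ≤ _) hg
  rw [Ideal.map_span, Ideal.span_le]
  rintro _ ⟨_, ⟨i, rfl⟩, rfl⟩
  rw [SetLike.mem_coe, Ideal.mem_comap, Ideal.mem_span_singleton]
  cases i using Fin.cases <;>
    simp [sliceHom_apply, finSuccEquiv_apply]

end Slice

end MvPolynomial

section VanishingOrder

open MvPolynomial

variable {F : Type*} [Field F] {n : ℕ}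

theorem bddAbove_vanishingOrder_set {P : MvPolynomial (Fin n) F} (hP : P ≠ 0) (p : Fin n → F) :
    BddAbove {m : ℕ | P ∈ (Ideal.span (Set.range fun i => X i - C (p i))) ^ m} := by
  obtain ⟨e, he⟩ := ne_zero_iff.1 (translate_ne_zero p hP)
  refine ⟨e.degree, fun m hm => ?_⟩
  by_contra! h
  exact he ((mem_span_X_sub_C_pow_iff p m P).1 hm e h)

theorem mem_pow_vanishingOrder {P : MvPolynomial (Fin n) F} (hP : P ≠ 0) (p : Fin n → F) :
    P ∈ (Ideal.span (Set.range fun i => X i - C (p i))) ^ vanishingOrder P p :=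
  Nat.sSup_mem (s := {m : ℕ | P ∈ (Ideal.span (Set.range fun i => X i - C (p i))) ^ m})
    ⟨0, by simp⟩ (bddAbove_vanishingOrder_set hP p)

theorem exists_coeff_translate_ne_zero {P : MvPolynomial (Fin n) F} (hP : P ≠ 0)
    (p : Fin n → F) :
    ∃ e : Fin n →₀ ℕ, e.degree ≤ vanishingOrder P p ∧ coeff e (translate p P) ≠ 0 := by
  by_contra! h
  have : vanishingOrder P p + 1 ≤ vanishingOrder P p :=
    le_csSup (bddAbove_vanishingOrder_set hP p)
      ((mem_span_X_sub_C_pow_iff p _ P).2 fun e he => h e (Nat.lt_succ_iff.1 he))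
  omega

/-- The orders of vanishing of `P` along the line through `a` in the direction of the first
variable are controlled by the leading coefficient of `P` in that variable. -/
theorem sum_vanishingOrder_cons_le [Fintype F] {P : MvPolynomial (Fin (n + 1)) F} (hP : P ≠ 0)
    (a : Fin n → F) :
    ∑ b : F, vanishingOrder P (Fin.cons b a : Fin (n + 1) → F) ≤
      Fintype.card F * vanishingOrder (finSuccEquiv F n P).leadingCoeff a +
        (finSuccEquiv F n P).natDegree := by
  classical
  have hf : finSuccEquiv F n P ≠ 0 := EmbeddingLike.map_ne_zero_iff.2 hP
  obtain ⟨e, he, hne⟩ :=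
    exists_coeff_translate_ne_zero (Polynomial.leadingCoeff_ne_zero.2 hf) a
  set f := finSuccEquiv F n P
  set Q := coeff e (sliceHom a P)
  have hQ : Q ≠ 0 := by
    intro h
    apply hne
    rw [Polynomial.leadingCoeff, ← coeff_coeff_sliceHom]
    change Q.coeff _ = 0
    rw [h, Polynomial.coeff_zero]
  have hdeg : Q.natDegree ≤ f.natDegree := by
    rw [Polynomial.natDegree_le_iff_coeff_eq_zero]
    intro j hj
    rw [coeff_coeff_sliceHom, Polynomial.coeff_eq_zero_of_natDegree_lt hj, map_zero, coeff_zero]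
  have hroots : ∑ b : F, Q.rootMultiplicity b ≤ Q.natDegree := by
    simp_rw [← Polynomial.count_roots]
    rw [Multiset.sum_count_eq_card fun _ _ => Finset.mem_univ _]
    exact Q.card_roots'
  calc
    _ ≤ ∑ b : F, (vanishingOrder f.leadingCoeff a + Q.rootMultiplicity b) := by
      refine Finset.sum_le_sum fun b _ => ?_
      have := (Polynomial.le_rootMultiplicity_iff hQ).2
        (pow_dvd_coeff_sliceHom b a (mem_pow_vanishingOrder hP _) e)
      omega
    _ ≤ _ := by
      rw [Finset.sum_add_distrib, Finset.sum_const, Finset.card_univ, smul_eq_mul]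
      omega

theorem sum_vanishingOrder_mul_card_le [Fintype F] {P : MvPolynomial (Fin n) F} (hP : P ≠ 0) :
    (∑ p : Fin n → F, vanishingOrder P p) * Fintype.card F ≤
      P.totalDegree * Fintype.card F ^ n := by
  induction n with
  | zero =>
    have h : ∀ p : Fin 0 → F, vanishingOrder P p = 0 := by
      intro p
      have hmem := mem_pow_vanishingOrder hP p
      by_contra h0
      rw [Set.range_eq_empty, Ideal.span_empty, Ideal.bot_pow h0] at hmem
      exact hP hmem
    simp [h]
  | succ n ih =>
    have hf : finSuccEquiv F n P ≠ 0 := EmbeddingLike.map_ne_zero_iff.2 hP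
    have hlc := Polynomial.leadingCoeff_ne_zero.2 hf
    have hdeg := totalDegree_coeff_finSuccEquiv_add_le P (finSuccEquiv F n P).natDegree hlc
    have hsum : ∑ p : Fin (n + 1) → F, vanishingOrder P p ≤
        P.totalDegree * Fintype.card F ^ n := by
      calc
        _ = ∑ a : Fin n → F, ∑ b : F, vanishingOrder P (Fin.cons b a : Fin (n + 1) → F) := by
          rw [← (Fin.consEquiv fun _ : Fin (n + 1) => F).sum_comp, Fintype.sum_prod_type_right]
          rfl
        _ ≤ ∑ a : Fin n → F, (Fintype.card F *
            vanishingOrder (finSuccEquiv F n P).leadingCoeff a +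
              (finSuccEquiv F n P).natDegree) :=
          Finset.sum_le_sum fun a _ => sum_vanishingOrder_cons_le hP a
        _ = (∑ a : Fin n → F, vanishingOrder (finSuccEquiv F n P).leadingCoeff a) *
              Fintype.card F + (finSuccEquiv F n P).natDegree * Fintype.card F ^ n := by
          rw [Finset.sum_add_distrib, ← Finset.mul_sum, mul_comm]
          simp [mul_comm]
        _ ≤ (finSuccEquiv F n P).leadingCoeff.totalDegree * Fintype.card F ^ n +
              (finSuccEquiv F n P).natDegree * Fintype.card F ^ n := by
          exact Nat.add_le_add_right (ih hlc) _
        _ ≤ _ := by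
          rw [← add_mul]
          gcongr
          exact hdeg
    rw [pow_succ, ← mul_assoc]
    gcongr

end VanishingOrder

/-- **Schwartz–Zippel lemma with multiplicity** (Lemma 2.2). -/
theorem schwartz_zippel_with_multiplicity (F : Type*) [Field F] [Fintype F]
    (n : ℕ) (hn : 1 ≤ n) (d : ℕ)
    (P : MvPolynomial (Fin n) F) (hP : P ≠ 0) (hdeg : P.totalDegree ≤ d) :
    ∑ p : Fin n → F, vanishingOrder P p ≤ d * Fintype.card F ^ (n - 1) := by
  refine Nat.le_of_mul_le_mul_right ?_ (Fintype.card_pos (α := F))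
  rw [mul_assoc, pow_sub_one_mul (by omega)]
  exact (sum_vanishingOrder_mul_card_le hP).trans (Nat.mul_le_mul_right _ hdeg)
end

section
/- Let F be a finite field, let n ≥ 1 be an integer, and let E ⊆ Fⁿ be a Kakeya set. Then |E| ≥ 2^(−n)·|F|ⁿ, i.e. 2ⁿ·|E| ≥ |F|ⁿ. -/
namespace Kakeya

open MvPolynomial

/-- The translate `P (x + a)` of a polynomial `P (x)`. -/
noncomputable def translate {σ R : Type*} [CommRing R] (a : σ → R) :
    MvPolynomial σ R →ₐ[R] MvPolynomial σ R :=
  aeval fun i => X i + C (a i)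

/-- `P` vanishes at `a` with multiplicity at least `m`. -/
def VanishesToOrder {σ R : Type*} [CommRing R] (P : MvPolynomial σ R) (a : σ → R) (m : ℕ) : Prop :=
  ∀ w : σ →₀ ℕ, w.degree < m → coeff w (translate a P) = 0

/-- The substitution `x ↦ t • b + x`, where `t` is a new variable adjoined to the coefficients. -/
noncomputable def alongLine {σ R : Type*} [CommRing R] (b : σ → R) :
    MvPolynomial σ R →ₐ[R] MvPolynomial σ (Polynomial R) :=
  aeval fun i => X i + C (Polynomial.X * Polynomial.C (b i))

section Univariate

variable {F : Type*} [Field F] [Fintype F]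

lemma eq_zero_of_taylor_coeff_eq_zero {p : Polynomial F} {k : ℕ}
    (h : ∀ b : F, ∀ j < k, (Polynomial.taylor b p).coeff j = 0)
    (hd : p.natDegree < Fintype.card F * k) : p = 0 := by
  by_contra hp
  have hdvd : (∏ b : F, (Polynomial.X - Polynomial.C b) ^ k) ∣ p := by
    refine Fintype.prod_dvd_of_coprime (fun x y hxy => ?_) fun b => ?_
    · exact (Polynomial.pairwise_coprime_X_sub_C Function.injective_id hxy).pow
    · rw [Polynomial.X_sub_C_pow_dvd_iff, ← Polynomial.taylor_apply, Polynomial.X_pow_dvd_iff]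
      exact h b
  have hle := Polynomial.natDegree_le_of_dvd hdvd hp
  rw [Polynomial.natDegree_prod _ _ fun b _ => pow_ne_zero _ (Polynomial.X_sub_C_ne_zero b)] at hle
  simp at hle
  omega

lemma exists_polynomial_coeff_taylor {R A : Type*} [CommRing R] [CommRing A] [Algebra R A]
    (L : A →ₗ[R] R) (g : Polynomial A) :
    ∃ p : Polynomial R, (∀ j, p.coeff j = L (g.coeff j)) ∧
      ∀ b j, (Polynomial.taylor b p).coeff j =
        L ((Polynomial.taylor (algebraMap R A b) g).coeff j) := by
  induction g using Polynomial.induction_on' with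
  | add f g hf hg =>
    obtain ⟨p, hp, hp'⟩ := hf
    obtain ⟨r, hr, hr'⟩ := hg
    exact ⟨p + r, fun j => by simp [hp, hr], fun b j => by simp [hp', hr']⟩
  | monomial k c =>
    refine ⟨Polynomial.monomial k (L c), fun j => ?_, fun b j => ?_⟩
    · simp only [Polynomial.coeff_monomial]
      split_ifs <;> simp
    · simp only [Polynomial.taylor_monomial, Polynomial.coeff_C_mul, Polynomial.coeff_X_add_C_pow]
      have : c * (algebraMap R A b ^ (k - j) * (k.choose j : A)) =
          (b ^ (k - j) * (k.choose j : R)) • c := by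
        rw [Algebra.smul_def]; simp [mul_comm]
      rw [this, map_smul, smul_eq_mul, mul_comm]

end Univariate

section Multivariate

variable {F : Type*} [Field F]

lemma finSuccEquiv_translate {n : ℕ} (b : F) (a : Fin n → F) (P : MvPolynomial (Fin (n + 1)) F) :
    finSuccEquiv F n (translate (Fin.cons b a) P) =
      Polynomial.taylor (algebraMap F _ b)
        ((finSuccEquiv F n P).map (translate a : _ →ₐ[F] _).toRingHom) := by
  induction P using MvPolynomial.induction_on with
  | C c => simp [translate, finSuccEquiv_apply]
  | add p r hp hr => simp only [map_add, Polynomial.map_add, hp, hr]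
  | mul_X p i hp =>
    have hX : finSuccEquiv F n (translate (Fin.cons b a) (X i)) =
        Polynomial.taylor (algebraMap F _ b)
          ((finSuccEquiv F n (X i)).map (translate a : _ →ₐ[F] _).toRingHom) := by
      refine Fin.cases ?_ (fun i => ?_) i
      · simp [translate, finSuccEquiv_apply]
      · simp [translate, finSuccEquiv_apply]
    rw [map_mul, map_mul, map_mul, Polynomial.map_mul, hp, hX, Polynomial.taylor_mul]

/-- A Schwartz–Zippel bound with multiplicities, over the full grid `Fⁿ`. -/
theorem eq_zero_of_vanishesToOrder [Fintype F] {n : ℕ} {P : MvPolynomial (Fin n) F} {l : ℕ}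
    (hP : ∀ a, VanishesToOrder P a l) (hd : P.totalDegree < Fintype.card F * l) : P = 0 := by
  induction n generalizing l with
  | zero =>
    obtain ⟨c, rfl⟩ := C_surjective (Fin 0) P
    have hl : 0 < l := Nat.pos_of_ne_zero (by rintro rfl; simp at hd)
    have := hP 0 0 (by simpa using hl)
    simp [translate] at this
    simp [this]
  | succ n ih =>
    by_contra hP0
    set f := finSuccEquiv F n P with hf
    have hf0 : f ≠ 0 := by simpa [hf] using hP0
    set t := f.natDegree with ht
    have hlead : f.coeff t ≠ 0 := by simpa [ht] using hf0
    have hdeg := totalDegree_coeff_finSuccEquiv_add_le P t hlead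
    have hq : 0 < Fintype.card F := Fintype.card_pos
    refine hlead (ih (l := l - t / Fintype.card F) (fun a w hw => ?_) ?_)
    · obtain ⟨p, hp, hp'⟩ := exists_polynomial_coeff_taylor (lcoeff F w)
        (f.map (translate a : _ →ₐ[F] _).toRingHom)
      have : p = 0 := by
        refine eq_zero_of_taylor_coeff_eq_zero (k := l - w.degree) (fun b j hj => ?_) ?_
        · rw [hp', ← finSuccEquiv_translate, lcoeff_apply, finSuccEquiv_coeff_coeff]
          refine hP _ _ ?_
          rw [Finsupp.degree_eq_sum, Fin.sum_univ_succ]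
          simp only [Finsupp.cons_zero, Finsupp.cons_succ, ← Finsupp.degree_eq_sum]
          omega
        · have h1 : p.natDegree ≤ t := by
            refine Polynomial.natDegree_le_iff_coeff_eq_zero.2 fun j hj => ?_
            rw [hp, Polynomial.coeff_map, Polynomial.coeff_eq_zero_of_natDegree_lt hj]
            simp
          calc p.natDegree ≤ t := h1
            _ < Fintype.card F * (t / Fintype.card F + 1) := Nat.lt_mul_div_succ t hq
            _ ≤ _ := Nat.mul_le_mul_left _ (by omega)
      have h2 := hp t
      rw [this] at h2
      simpa using h2.symm
    · have h3 : Fintype.card F * (t / Fintype.card F) ≤ t := Nat.mul_div_le _ _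
      rw [Nat.mul_sub]
      change (f.coeff t).totalDegree + t ≤ _ at hdeg
      omega

/-- Coefficients of a monomial along a line through the origin are single powers of `t`. -/
lemma coeff_alongLine_monomial {σ : Type*} (b : σ → F) (s w : σ →₀ ℕ) :
    (s.degree < w.degree → coeff w (translate b (monomial s 1)) = 0) ∧
      coeff w (alongLine b (monomial s 1)) =
        Polynomial.C (coeff w (translate b (monomial s 1))) *
          Polynomial.X ^ (s.degree - w.degree) := by
  revert w
  let Q (s : σ →₀ ℕ) : Prop := ∀ w : σ →₀ ℕ,
    (s.degree < w.degree → coeff w (translate b (monomial s 1)) = 0) ∧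
      coeff w (alongLine b (monomial s 1)) =
        Polynomial.C (coeff w (translate b (monomial s 1))) *
          Polynomial.X ^ (s.degree - w.degree)
  change Q s
  classical
  have key : ∀ s s' : σ →₀ ℕ, Q s → Q s' → Q (s + s') := by
    intro s s' hs hs' w
    have hm : monomial (s + s') (1 : F) = monomial s 1 * monomial s' 1 := by
      simp [monomial_mul]
    rw [hm, map_mul, map_mul, coeff_mul, coeff_mul]
    constructor
    · intro h
      refine Finset.sum_eq_zero fun x hx => ?_
      rw [Finset.HasAntidiagonal.mem_antidiagonal] at hx
      rw [← hx, map_add, map_add] at h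
      rcases lt_or_ge s.degree x.1.degree with h1 | h1
      · rw [(hs _).1 h1, zero_mul]
      · rw [(hs' _).1 (by omega), mul_zero]
    · rw [map_sum, Finset.sum_mul]
      refine Finset.sum_congr rfl fun x hx => ?_
      rw [Finset.HasAntidiagonal.mem_antidiagonal] at hx
      rw [(hs _).2, (hs' _).2, Polynomial.C_mul, ← hx, map_add, map_add]
      rcases lt_or_ge s.degree x.1.degree with h1 | h1
      · rw [(hs _).1 h1]; simp
      rcases lt_or_ge s'.degree x.2.degree with h2 | h2
      · rw [(hs' _).1 h2]; simp
      rw [show s.degree + s'.degree - (x.1.degree + x.2.degree) =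
        (s.degree - x.1.degree) + (s'.degree - x.2.degree) by omega, pow_add]
      ring
  have zero : Q 0 := by
    intro w
    have : monomial (0 : σ →₀ ℕ) (1 : F) = 1 := rfl
    simp only [this, map_one, coeff_one]
    refine ⟨fun h => if_neg ?_, ?_⟩
    · rintro rfl; simp at h
    · split_ifs <;> simp
  have single : ∀ i, Q (Finsupp.single i 1) := by
    intro i w
    have : monomial (Finsupp.single i 1) (1 : F) = X i := rfl
    simp only [this, translate, alongLine, aeval_X, coeff_add, coeff_C, coeff_X,
      Finsupp.degree_single]
    refine ⟨fun h => ?_, ?_⟩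
    · rw [if_neg, if_neg, add_zero]
      · rintro rfl; simp at h
      · rintro rfl; simp at h
    · have hi : (0 : σ →₀ ℕ) ≠ Finsupp.single i 1 := by simp [eq_comm]
      by_cases h0 : 0 = w
      · subst h0; simp [hi.symm, Polynomial.X_mul_C]
      · by_cases h1 : Finsupp.single i 1 = w
        · subst h1; simp [hi]
        · simp [h0, h1]
  induction s using Finsupp.induction_linear with
  | zero => exact zero
  | add s s' hs hs' => exact key s s' hs hs'
  | single i k =>
    induction k with
    | zero => simpa using zero
    | succ k ih =>
      rw [Finsupp.single_add]
      exact key _ _ ih (single i)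

lemma coeff_translate_eq_sum {σ : Type*} (b : σ → F) (P : MvPolynomial σ F) (w : σ →₀ ℕ) :
    coeff w (translate b P) =
      ∑ s ∈ P.support, coeff s P * coeff w (translate b (monomial s 1)) := by
  conv_lhs => rw [P.as_sum]
  rw [map_sum, coeff_sum]
  refine Finset.sum_congr rfl fun s _ => ?_
  rw [← mul_one (coeff s P), ← smul_eq_mul, ← smul_monomial, map_smul, coeff_smul]
  simp

lemma coeff_alongLine_eq_sum {σ : Type*} (b : σ → F) (P : MvPolynomial σ F) (w : σ →₀ ℕ) :
    coeff w (alongLine b P) =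
      ∑ s ∈ P.support, Polynomial.C (coeff s P * coeff w (translate b (monomial s 1))) *
        Polynomial.X ^ (s.degree - w.degree) := by
  conv_lhs => rw [P.as_sum]
  rw [map_sum, coeff_sum]
  refine Finset.sum_congr rfl fun s _ => ?_
  rw [← mul_one (coeff s P), ← smul_eq_mul, ← smul_monomial, map_smul, coeff_smul,
    (coeff_alongLine_monomial b s w).2, Polynomial.smul_eq_C_mul, smul_eq_mul, mul_one,
    Polynomial.C_mul, mul_assoc]

lemma map_eval_zero_alongLine {σ : Type*} (b : σ → F) (P : MvPolynomial σ F) :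
    map (Polynomial.evalRingHom 0) (alongLine b P) = P := by
  induction P using MvPolynomial.induction_on with
  | C c => simp [alongLine, MvPolynomial.algebraMap_apply]
  | add p r hp hr => rw [map_add, map_add, hp, hr]
  | mul_X p i hp =>
    rw [map_mul, map_mul, hp]
    simp [alongLine]

lemma map_taylor_alongLine {σ : Type*} (b : σ → F) (t : F) (P : MvPolynomial σ F) :
    map (Polynomial.taylorAlgHom t : _ →ₐ[F] _).toRingHom (alongLine b P) =
      alongLine b (translate (t • b) P) := by
  induction P using MvPolynomial.induction_on with
  | C c => simp [alongLine, translate, MvPolynomial.algebraMap_apply]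
  | add p r hp hr => rw [map_add, map_add, hp, hr, map_add, map_add]
  | mul_X p i hp =>
    rw [map_mul, map_mul, hp, map_mul, map_mul]
    congr 1
    simp [alongLine, translate, MvPolynomial.algebraMap_apply]
    ring

lemma translate_translate {σ : Type*} (a b : σ → F) (P : MvPolynomial σ F) :
    translate b (translate a P) = translate (a + b) P := by
  induction P using MvPolynomial.induction_on with
  | C c => simp [translate]
  | add p r hp hr => rw [map_add, map_add, hp, hr, map_add]
  | mul_X p i hp =>
    rw [map_mul, map_mul, hp, map_mul]
    congr 1
    simp [translate]
    ring

lemma coeff_translate_monomial {σ : Type*} (a : σ → F) {s w : σ →₀ ℕ} (h : s.degree ≤ w.degree) :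
    coeff w (translate a (monomial s 1)) = coeff w (monomial s (1 : F)) := by
  have h1 := congrArg (coeff w) (map_eval_zero_alongLine a (monomial s (1 : F)))
  rw [coeff_map, (coeff_alongLine_monomial a s w).2, Nat.sub_eq_zero_of_le h] at h1
  simpa using h1

lemma coeff_translate_of_totalDegree_le {σ : Type*} (a : σ → F) {P : MvPolynomial σ F}
    {w : σ →₀ ℕ} (h : P.totalDegree ≤ w.degree) : coeff w (translate a P) = coeff w P := by
  rw [coeff_translate_eq_sum]
  conv_rhs => rw [P.as_sum, coeff_sum]
  refine Finset.sum_congr rfl fun s hs => ?_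
  rw [coeff_translate_monomial a ((le_totalDegree hs).trans h)]
  classical simp [coeff_monomial]

lemma totalDegree_translate_le {σ : Type*} (a : σ → F) (P : MvPolynomial σ F) :
    (translate a P).totalDegree ≤ P.totalDegree := by
  refine Finset.sup_le fun w hw => ?_
  by_contra! h
  change P.totalDegree < w.degree at h
  rw [mem_support_iff, coeff_translate_of_totalDegree_le a h.le,
    coeff_eq_zero_of_totalDegree_lt h] at hw
  exact hw rfl

lemma homogeneousComponent_translate {σ : Type*} (a : σ → F) (P : MvPolynomial σ F) :
    homogeneousComponent P.totalDegree (translate a P) =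
      homogeneousComponent P.totalDegree P := by
  ext w
  rw [coeff_homogeneousComponent, coeff_homogeneousComponent]
  split_ifs with h
  · exact coeff_translate_of_totalDegree_le a h.ge
  · rfl

lemma X_pow_dvd_coeff_alongLine {σ : Type*} (b : σ → F) {P : MvPolynomial σ F} {m : ℕ}
    (h : ∀ s : σ →₀ ℕ, s.degree < m → coeff s P = 0) (w : σ →₀ ℕ) :
    Polynomial.X ^ (m - w.degree) ∣ coeff w (alongLine b P) := by
  rw [coeff_alongLine_eq_sum]
  refine Finset.dvd_sum fun s hs => Dvd.dvd.mul_left (pow_dvd_pow _ ?_) _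
  have : m ≤ s.degree := not_lt.1 fun hlt => mem_support_iff.1 hs (h s hlt)
  omega

lemma natDegree_coeff_alongLine_le {σ : Type*} (b : σ → F) {P : MvPolynomial σ F} {d : ℕ}
    (h : P.totalDegree ≤ d) (w : σ →₀ ℕ) :
    (coeff w (alongLine b P)).natDegree ≤ d - w.degree := by
  rw [coeff_alongLine_eq_sum]
  refine Polynomial.natDegree_sum_le_of_forall_le _ _ fun s hs => ?_
  have : s.degree ≤ d := (le_totalDegree hs).trans h
  exact (Polynomial.natDegree_C_mul_X_pow_le _ _).trans (by omega)

lemma coeff_coeff_alongLine {σ : Type*} (b : σ → F) {P : MvPolynomial σ F} {d : ℕ}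
    (h : P.totalDegree ≤ d) {w : σ →₀ ℕ} (hw : w.degree ≤ d) :
    (coeff w (alongLine b P)).coeff (d - w.degree) =
      coeff w (translate b (homogeneousComponent d P)) := by
  classical
  rw [coeff_alongLine_eq_sum, Polynomial.finsetSum_coeff, homogeneousComponent_apply,
    map_sum, coeff_sum, Finset.sum_filter]
  refine Finset.sum_congr rfl fun s hs => ?_
  have hsd : s.degree ≤ d := (le_totalDegree hs).trans h
  rw [Polynomial.coeff_C_mul_X_pow, ← mul_one (coeff s P), ← smul_eq_mul (coeff s P) 1,
    ← smul_monomial, map_smul, coeff_smul, smul_eq_mul, smul_eq_mul, mul_one]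
  by_cases hs' : s.degree = d
  · simp [hs']
  · rw [if_neg hs']
    rcases lt_or_ge s.degree w.degree with h1 | h1
    · simp [(coeff_alongLine_monomial b s w).1 h1]
    · rw [if_neg (by omega)]

/-- If `P` vanishes to high order along a line in direction `b`, its leading form vanishes to
high order at `b`. -/
theorem VanishesToOrder.homogeneousComponent [Fintype F] {σ : Type*} {a b : σ → F}
    {P : MvPolynomial σ F} {m l : ℕ} (hP : ∀ t : F, VanishesToOrder P (a + t • b) m)
    (hlm : ∀ k < l, P.totalDegree - k < Fintype.card F * (m - k)) :
    VanishesToOrder (homogeneousComponent P.totalDegree P) b l := by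
  intro w hw
  rcases lt_or_ge P.totalDegree w.degree with h | h
  · have hle : (MvPolynomial.homogeneousComponent P.totalDegree P).totalDegree ≤ P.totalDegree :=
      (homogeneousComponent_isHomogeneous _ _).totalDegree_le
    rw [coeff_translate_of_totalDegree_le _ (hle.trans h.le)]
    exact coeff_eq_zero_of_totalDegree_lt (hle.trans_lt h)
  · rw [← homogeneousComponent_translate a,
      ← coeff_coeff_alongLine b (totalDegree_translate_le a P) h]
    suffices coeff w (alongLine b (translate a P)) = 0 by simp [this]
    refine eq_zero_of_taylor_coeff_eq_zero (k := m - w.degree) (fun t j hj => ?_)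
      ((natDegree_coeff_alongLine_le b (totalDegree_translate_le a P) w).trans_lt (hlm _ hw))
    have h1 := X_pow_dvd_coeff_alongLine b (hP t) w
    rw [← translate_translate, ← map_taylor_alongLine, coeff_map] at h1
    exact Polynomial.X_pow_dvd_iff.1 h1 j hj

/-- The exponents of the monomials of degree less than `k`. -/
def exponentsLT (n k : ℕ) : Finset (Fin n →₀ ℕ) :=
  (Finset.range k).biUnion fun j => Finset.finsuppAntidiag Finset.univ j

lemma mem_exponentsLT {n k : ℕ} {s : Fin n →₀ ℕ} : s ∈ exponentsLT n k ↔ s.degree < k := by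
  simp [exponentsLT, Finsupp.degree_eq_sum]

lemma card_exponentsLT {n : ℕ} (hn : 1 ≤ n) (k : ℕ) :
    (exponentsLT n k).card = (k + n - 1).choose n := by
  obtain ⟨n, rfl⟩ := Nat.exists_eq_add_of_le' hn
  rw [exponentsLT, Finset.card_biUnion]
  · cases k with
    | zero => simp
    | succ k =>
      rw [show k + 1 + (n + 1) - 1 = k + n + 1 by omega, ← Nat.sum_range_add_choose]
      refine Finset.sum_congr rfl fun j _ => ?_
      rw [Finset.card_finsuppAntidiag_nat_eq_choose, Finset.card_univ, Fintype.card_fin,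
        show n + 1 + j - 1 = j + n by omega, Nat.choose_symm_add]
  · intro i _ j _ hij
    refine Finset.disjoint_left.2 fun s hi hj => hij ?_
    rw [Finset.mem_finsuppAntidiag] at hi hj
    exact hi.1.symm.trans hj.1

/-- Interpolation with multiplicities, by counting dimensions. -/
theorem exists_vanishesToOrder {n : ℕ} (E : Finset (Fin n → F)) {m D : ℕ}
    (h : E.card * (exponentsLT n m).card < (exponentsLT n D).card) :
    ∃ P : MvPolynomial (Fin n) F, P ≠ 0 ∧ P.totalDegree < D ∧
      ∀ a ∈ E, VanishesToOrder P a m := by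
  let T : (exponentsLT n D → F) →ₗ[F] MvPolynomial (Fin n) F :=
    ∑ s, (monomial s.1).comp (LinearMap.proj s)
  let L : (exponentsLT n D → F) →ₗ[F] (E × exponentsLT n m → F) :=
    LinearMap.pi fun x => (lcoeff F x.2.1).comp ((translate x.1.1).toLinearMap.comp T)
  have hL : LinearMap.ker L ≠ ⊥ := L.ker_ne_bot_of_finrank_lt (by simpa using h)
  obtain ⟨c, hc, hc0⟩ := (Submodule.ne_bot_iff _).1 hL
  have hT : ∀ s, coeff s (T c) = if hs : s ∈ exponentsLT n D then c ⟨s, hs⟩ else 0 := by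
    classical
    intro s
    simp only [T, LinearMap.sum_apply, LinearMap.comp_apply, LinearMap.proj_apply, coeff_sum,
      coeff_monomial]
    split_ifs with hs
    · rw [Finset.sum_eq_single ⟨s, hs⟩] <;> simp +contextual [Subtype.ext_iff]
    · refine Finset.sum_eq_zero fun x _ => if_neg ?_
      rintro rfl
      exact hs x.2
  obtain ⟨s, hs⟩ := Function.ne_iff.1 hc0
  have hs' : s.1.degree < D := mem_exponentsLT.1 s.2
  refine ⟨T c, fun h0 => hs ?_, ?_, fun a ha w hw => ?_⟩
  · simpa [h0] using (hT s.1).symm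
  · rw [totalDegree, Finset.sup_lt_iff (bot_lt_of_lt hs')]
    intro r hr
    by_contra hrD
    rw [mem_support_iff, hT, dif_neg (fun h => hrD (mem_exponentsLT.1 h))] at hr
    exact hr rfl
  · exact congrFun (LinearMap.mem_ker.1 hc) (⟨a, ha⟩, ⟨w, mem_exponentsLT.2 hw⟩)

end Multivariate

end Kakeya

open MvPolynomial Kakeya in
/-- **Improved bound on Kakeya sets** (Theorem 2.5). -/
theorem kakeya_improved (F : Type*) [Field F] [Fintype F] (n : ℕ) (hn : 1 ≤ n)
    (E : Set (Fin n → F))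
    (hE : ∀ v : Fin n → F, v ≠ 0 → ∃ x : Fin n → F, ∀ t : F, x + t • v ∈ E) :
    Fintype.card F ^ n ≤ 2 ^ n * E.ncard := by
  classical
  have hlines : ∀ v : Fin n → F, ∃ x : Fin n → F, ∀ t : F, x + t • v ∈ E := by
    intro v
    by_cases hv : v = 0
    · obtain ⟨x, hx⟩ := hE (fun _ => 1) fun h => one_ne_zero (congrFun h ⟨0, hn⟩)
      exact ⟨x, fun t => by simpa [hv] using hx 0⟩
    · exact hE v hv
  by_contra! hlt
  set q := Fintype.card F with hq
  have hq1 : 1 ≤ q := Fintype.card_pos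
  have hqn : n ≤ q * n := Nat.le_mul_of_pos_left n hq1
  obtain ⟨P, hP0, hPd, hPE⟩ := exists_vanishesToOrder (m := 2 * (q * n) - n) (D := q * n * q)
    E.toFinset (by
      rw [card_exponentsLT hn, card_exponentsLT hn, ← Set.ncard_eq_toFinset_card']
      refine lt_of_mul_lt_mul_left (a := n.factorial) ?_ (Nat.zero_le _)
      calc n.factorial * (E.ncard * (2 * (q * n) - n + n - 1).choose n)
          = E.ncard * (2 * (q * n) - n + n - 1).descFactorial n := by
            rw [Nat.descFactorial_eq_factorial_mul_choose]; ring
        _ ≤ E.ncard * (2 * (q * n)) ^ n := by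
            gcongr
            exact (Nat.descFactorial_le_pow _ _).trans (Nat.pow_le_pow_left (by omega) _)
        _ = 2 ^ n * E.ncard * (q * n) ^ n := by rw [mul_pow 2]; ring
        _ < q ^ n * (q * n) ^ n := by gcongr
        _ = (q * n * q) ^ n := by ring
        _ ≤ (q * n * q).ascFactorial n := Nat.pow_succ_le_ascFactorial _ _
        _ = _ := Nat.ascFactorial_eq_factorial_mul_choose' _ _)
  have hH : homogeneousComponent P.totalDegree P = 0 := by
    refine eq_zero_of_vanishesToOrder (l := q * n) (fun b => ?_) ?_
    · obtain ⟨x, hx⟩ := hlines b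
      refine VanishesToOrder.homogeneousComponent (m := 2 * (q * n) - n)
        (fun t => hPE _ (by simpa using hx t)) fun k hk => ?_
      obtain ⟨r, hr⟩ := Nat.exists_eq_add_of_lt hk
      have h1 : 2 * (q * n) - n - k = (q * n - n) + r + 1 := by omega
      have h2 : q * (q * n - n) + q * n = q * n * q := by
        rw [← Nat.mul_add, Nat.sub_add_cancel hqn, mul_comm]
      have h3 : r ≤ q * r := Nat.le_mul_of_pos_left r hq1
      rw [← hq, h1, mul_add, mul_add, mul_one]
      omega
    · refine (homogeneousComponent_isHomogeneous _ _).totalDegree_le.trans_lt ?_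
      rwa [mul_comm q (q * n)]
  obtain ⟨s, hs, hsd⟩ := Finset.exists_mem_eq_sup P.support (support_nonempty.2 hP0)
    fun s => s.degree
  have hs0 := congrArg (coeff s) hH
  change P.totalDegree = s.degree at hsd
  rw [coeff_homogeneousComponent, if_pos hsd.symm, coeff_zero] at hs0
  exact mem_support_iff.1 hs hs0
end

section
/- Let F be a field, let n ≥ 2 be an integer, and let L be a finite set of N lines in Fⁿ. Call a point p ∈ Fⁿ a joint of L if there are n lines in L passing through p whose direction vectors are linearly independent over F (equivalently, the n lines do not all lie in a common hyperplane). Then the number of joints of L is at most n·N^(n/(n−1)) (as an inequality of real numbers). -/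
theorem MvPolynomial.totalDegree_pow_of_isDomain {σ R : Type*} [CommRing R] [IsDomain R]
    {f : MvPolynomial σ R} (hf : f ≠ 0) (k : ℕ) : (f ^ k).totalDegree = k * f.totalDegree := by
  induction k with
  | zero => simp
  | succ k ih => rw [pow_succ, totalDegree_mul_of_isDomain (pow_ne_zero k hf) hf, ih]; ring

theorem MvPolynomial.natCast_eq_zero_of_pderiv_eq_zero {σ R : Type*} [CommRing R] [IsDomain R]
    {f : MvPolynomial σ R} (hf : ∀ i, pderiv i f = 0) {m : σ →₀ ℕ} (hm : m ∈ f.support) (i : σ) :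
    (m i : R) = 0 := by
  by_cases hi : m i = 0
  · simp [hi]
  have h := coeff_pderiv (i := i) f (m - Finsupp.single i 1)
  rw [hf i, coeff_zero, tsub_add_cancel_of_le
    (Finsupp.single_le_iff.2 (Nat.one_le_iff_ne_zero.2 hi))] at h
  have hcast := (mul_eq_zero.1 h.symm).resolve_left (mem_support_iff.1 hm)
  have hpred : (((m i - 1 + 1 : ℕ)) : R) = 0 := by simpa using hcast
  rwa [Nat.sub_add_cancel (Nat.one_le_iff_ne_zero.2 hi)] at hpred

theorem MvPolynomial.totalDegree_pderiv_lt {σ R : Type*} [CommSemiring R] {f : MvPolynomial σ R}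
    (hf : f.totalDegree ≠ 0) (i : σ) : (pderiv i f).totalDegree < f.totalDegree := by
  refine (Finset.sup_lt_iff (Nat.pos_of_ne_zero hf)).2 fun m hm ↦ ?_
  rw [mem_support_iff, coeff_pderiv] at hm
  have hle := le_totalDegree (mem_support_iff.2 (left_ne_zero_of_mul hm))
  rw [Finsupp.sum_add_index' (fun _ ↦ rfl) (fun _ _ _ ↦ rfl), Finsupp.sum_single_index rfl] at hle
  exact hle

theorem MvPolynomial.exists_pow_eq_of_pderiv_eq_zero {σ K : Type*} [Field K] (p : ℕ)
    [Fact p.Prime] [CharP K p] [PerfectRing K p] {f : MvPolynomial σ K}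
    (hf : ∀ i, pderiv i f = 0) : ∃ g : MvPolynomial σ K, g ^ p = f := by
  refine ⟨∑ m ∈ f.support, monomial (Finsupp.mapRange (fun a : ℕ ↦ a / p) (Nat.zero_div p) m)
    ((frobeniusEquiv K p).symm (f.coeff m)), ?_⟩
  rw [sum_pow_char]
  conv_rhs => rw [f.as_sum]
  refine Finset.sum_congr rfl fun m hm ↦ ?_
  rw [monomial_pow, frobeniusEquiv_symm_pow_p]
  refine congrArg (monomial · (f.coeff m)) (Finsupp.ext fun i ↦ ?_)
  have hdvd : p ∣ m i :=
    (CharP.cast_eq_zero_iff K p (m i)).1 (natCast_eq_zero_of_pderiv_eq_zero hf hm i)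
  simpa using Nat.mul_div_cancel' hdvd

/-- Over a perfect field, a nonconstant polynomial all of whose partial derivatives vanish is
a power of a polynomial of smaller degree. -/
theorem MvPolynomial.exists_pow_eq_totalDegree_lt {σ K : Type*} [Field K] [PerfectField K]
    {f : MvPolynomial σ K} (hf : ∀ i, pderiv i f = 0) (hdeg : f.totalDegree ≠ 0) :
    ∃ (g : MvPolynomial σ K) (k : ℕ), g ^ k = f ∧ g.totalDegree < f.totalDegree := by
  obtain ⟨p, hp⟩ := ExpChar.exists K
  cases hp with
  | zero =>
    refine absurd ((totalDegree_eq_zero_iff _ f).2 fun m hm i ↦ ?_) hdeg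
    exact_mod_cast natCast_eq_zero_of_pderiv_eq_zero hf hm i
  | prime hprime =>
    have : Fact p.Prime := ⟨hprime⟩
    obtain ⟨g, rfl⟩ := exists_pow_eq_of_pderiv_eq_zero p hf
    refine ⟨g, p, rfl, ?_⟩
    have hg : g ≠ 0 := by
      rintro rfl
      simp [hprime.ne_zero] at hdeg
    rw [totalDegree_pow_of_isDomain hg] at hdeg ⊢
    have h2 := hprime.two_le
    have : 0 < g.totalDegree := Nat.pos_of_ne_zero (right_ne_zero_of_mul hdeg)
    nlinarith

theorem MvPolynomial.derivative_aeval {σ R : Type*} [Fintype σ] [CommRing R]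
    (f : MvPolynomial σ R) (g : σ → Polynomial R) :
    Polynomial.derivative (aeval g f) =
      ∑ i, aeval g (pderiv i f) * Polynomial.derivative (g i) := by
  classical
  induction f using MvPolynomial.induction_on with
  | C a => simp
  | add p q hp hq => simp [hp, hq, add_mul, Finset.sum_add_distrib]
  | mul_X p j hp =>
    simp only [map_mul, aeval_X, Polynomial.derivative_mul, hp, pderiv_mul, map_add, add_mul,
      Finset.sum_add_distrib, Finset.sum_mul]
    refine congrArg₂ (· + ·) (Finset.sum_congr rfl fun i _ ↦ by ring) ?_
    rw [Finset.sum_eq_single j] <;> simp +contextual [pderiv_X]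

theorem MvPolynomial.eval_aeval_line {σ R : Type*} [CommRing R] (f : MvPolynomial σ R)
    (p v : σ → R) (t : R) :
    (aeval (fun i ↦ Polynomial.C (p i) + Polynomial.C (v i) * Polynomial.X) f).eval t =
      eval (p + t • v) f := by
  induction f using MvPolynomial.induction_on with
  | C a => simp
  | add p q hp hq => simp [hp, hq]
  | mul_X p j hp =>
    rw [map_mul, Polynomial.eval_mul, hp, map_mul, aeval_X, eval_X]
    simp [mul_comm t]

/-- If `f` has more than `f.totalDegree` zeros on the line through `p` with direction `v`, then its
derivative at `p` in direction `v` vanishes. -/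
theorem MvPolynomial.sum_mul_eval_pderiv_eq_zero {σ R : Type*} [Fintype σ] [CommRing R]
    [IsDomain R] {f : MvPolynomial σ R} {p v : σ → R} {S : Finset (σ → R)}
    (hS : ∀ q ∈ S, ∃ t : R, q = p + t • v) (hf : ∀ q ∈ S, eval q f = 0)
    (hcard : f.totalDegree < S.card) : ∑ i, v i * eval p (pderiv i f) = 0 := by
  set g : Polynomial R :=
    aeval (fun i ↦ Polynomial.C (p i) + Polynomial.C (v i) * Polynomial.X) f with hg
  have hdeg : g.natDegree ≤ f.totalDegree := by
    simpa using aeval_natDegree_le (n := 1) f le_rfl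
      (fun i ↦ Polynomial.C (p i) + Polynomial.C (v i) * Polynomial.X)
      (fun i ↦ by compute_degree)
  choose! t ht using hS
  have hg0 : g = 0 := by
    refine Polynomial.eq_zero_of_natDegree_lt_card_of_eval_eq_zero g (f := fun q : S ↦ t q) ?_ ?_ ?_
    · intro q r h
      refine Subtype.ext ?_
      rw [ht q q.2, ht r r.2]
      simp only at h
      rw [h]
    · intro q
      rw [hg, eval_aeval_line, ← ht q q.2, hf q q.2]
    · simpa using hdeg.trans_lt hcard
  have h := congrArg (Polynomial.eval 0) (derivative_aeval f
    (fun i ↦ Polynomial.C (p i) + Polynomial.C (v i) * Polynomial.X))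
  rw [← hg, hg0] at h
  simp only [Polynomial.derivative_zero, Polynomial.eval_zero, Polynomial.eval_finsetSum,
    Polynomial.eval_mul, eval_aeval_line, zero_smul, add_zero] at h
  simpa [mul_comm (v _)] using h.symm

/-- Parameter counting: a set of fewer than `(n + d).choose d` points lies on a hypersurface of
degree at most `d`. -/
theorem MvPolynomial.exists_ne_zero_eval_eq_zero {K : Type*} [Field K] {n d : ℕ}
    (J : Finset (Fin n → K)) (hJ : J.card < (n + d).choose d) :
    ∃ f : MvPolynomial (Fin n) K, f ≠ 0 ∧ f.totalDegree ≤ d ∧ ∀ q ∈ J, eval q f = 0 := by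
  classical
  set A := (Finset.univ : Finset (Option (Fin n))).finsuppAntidiag d with hA
  have hsum (m) (hm : m ∈ A) : m none + ∑ i, m (some i) = d := by
    simpa [hA, Finset.mem_finsuppAntidiag, Fintype.sum_option] using hm
  set S := A.image Finsupp.some with hS
  have hScard : S.card = (n + d).choose d := by
    rw [hS, Finset.card_image_of_injOn, hA, Finset.card_finsuppAntidiag_nat_eq_choose]
    · simp [Nat.add_right_comm]
    · intro a ha b hb hab
      have hsome (i : Fin n) : a (some i) = b (some i) := DFunLike.congr_fun hab i
      have ha := hsum a ha
      have hb := hsum b hb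
      ext i
      cases i with
      | none => simp only [hsome] at ha; omega
      | some i => exact hsome i
  let ev : restrictSupport K (S : Set (Fin n →₀ ℕ)) →ₗ[K] (J → K) :=
    (LinearMap.pi fun q : J ↦ (aeval (q : Fin n → K)).toLinearMap) ∘ₗ Submodule.subtype _
  have hfin : Module.finrank K (restrictSupport K (S : Set (Fin n →₀ ℕ))) = S.card := by
    simpa using Module.finrank_eq_card_basis (basisRestrictSupport K (S : Set (Fin n →₀ ℕ)))
  have : FiniteDimensional K (restrictSupport K (S : Set (Fin n →₀ ℕ))) :=
    Module.Finite.of_basis (basisRestrictSupport K (S : Set (Fin n →₀ ℕ)))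
  have hker : LinearMap.ker ev ≠ ⊥ := by
    apply LinearMap.ker_ne_bot_of_finrank_lt
    rw [hfin, hScard]
    simpa using hJ
  obtain ⟨f, hf, hf0⟩ := Submodule.exists_mem_ne_zero_of_ne_bot hker
  refine ⟨f, by simpa using hf0, ?_, fun q hq ↦ ?_⟩
  · have hsupp : (f : MvPolynomial (Fin n) K).support ⊆ S := fun m hm ↦ f.2 hm
    refine Finset.sup_le fun m hm ↦ ?_
    obtain ⟨a, ha, rfl⟩ := Finset.mem_image.1 (hsupp hm)
    have := hsum a ha
    rw [Finsupp.sum_fintype _ _ fun _ ↦ rfl]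
    simp only [Finsupp.some_apply]
    omega
  · have := congrFun (LinearMap.mem_ker.1 hf) ⟨q, hq⟩
    simpa [ev, aeval_eq_eval] using this

theorem MvPolynomial.exists_minimal_totalDegree_eval_eq_zero {K : Type*} [Field K] {n d : ℕ}
    (J : Finset (Fin n → K)) (hJ : J.card < (n + d).choose d) :
    ∃ f : MvPolynomial (Fin n) K, f ≠ 0 ∧ f.totalDegree ≤ d ∧ (∀ q ∈ J, eval q f = 0) ∧
      ∀ g, (∀ q ∈ J, eval q g = 0) → g.totalDegree < f.totalDegree → g = 0 := by
  obtain ⟨f₀, hf₀, hdeg, hvan⟩ := exists_ne_zero_eval_eq_zero J hJ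
  obtain ⟨f, ⟨hf, hfvan⟩, hmin⟩ := exists_minimalFor_of_wellFoundedLT
    (fun f : MvPolynomial (Fin n) K ↦ f ≠ 0 ∧ ∀ q ∈ J, eval q f = 0) totalDegree
    ⟨f₀, hf₀, hvan⟩
  have hle (g) (hg : g ≠ 0) (hgvan : ∀ q ∈ J, eval q g = 0) : f.totalDegree ≤ g.totalDegree := by
    by_contra! h
    exact h.not_ge (hmin ⟨hg, hgvan⟩ h.le)
  refine ⟨f, hf, (hle f₀ hf₀ hvan).trans hdeg, hfvan, fun g hg hlt ↦ ?_⟩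
  by_contra hg0
  exact hlt.not_ge (hle g hg0 hg)

/-- A point `p` is a joint of a family `L` of subsets of lines if `n` members of `L` through `p`
lie on lines through `p` with linearly independent directions. -/
def IsJoint {K : Type*} [Field K] {n : ℕ} (L : Finset (Set (Fin n → K))) (p : Fin n → K) : Prop :=
  ∃ v : Fin n → Fin n → K, LinearIndependent K v ∧
    ∀ i, ∃ ℓ ∈ L, p ∈ ℓ ∧ ∀ q ∈ ℓ, ∃ t : K, q = p + t • v i

open MvPolynomial Classical in
theorem IsJoint.exists_card_filter_le {K : Type*} [Field K] [PerfectField K] {n d : ℕ}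
    {L : Finset (Set (Fin n → K))} {J : Finset (Fin n → K)} (hJ : J.Nonempty)
    (hjoint : ∀ p ∈ J, IsJoint L p) (hcard : J.card < (n + d).choose d) :
    ∃ ℓ ∈ L, {p ∈ J | p ∈ ℓ}.card ≤ d := by
  by_contra! hL
  obtain ⟨f, hf0, hfd, hf, hmin⟩ := exists_minimal_totalDegree_eval_eq_zero J hcard
  have hdeg0 : f.totalDegree ≠ 0 := by
    intro h
    obtain ⟨q, hq⟩ := hJ
    rw [totalDegree_eq_zero_iff_eq_C] at h
    have := hf q hq
    rw [h, eval_C] at this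
    exact hf0 (by rw [h, this, C_0])
  have hgrad (p) (hp : p ∈ J) (i) : eval p (pderiv i f) = 0 := by
    obtain ⟨v, hv, hvL⟩ := hjoint p hp
    have hunit : IsUnit (Matrix.of v) := Matrix.linearIndependent_rows_iff_isUnit.1 hv
    have hdet : (Matrix.of v).det ≠ 0 := ((Matrix.isUnit_iff_isUnit_det _).1 hunit).ne_zero
    refine congrFun (Matrix.eq_zero_of_mulVec_eq_zero hdet
      (v := fun i ↦ eval p (pderiv i f)) (funext fun j ↦ ?_)) i
    obtain ⟨ℓ, hℓ, -, hline⟩ := hvL j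
    exact sum_mul_eval_pderiv_eq_zero (S := {p ∈ J | p ∈ ℓ})
      (fun q hq ↦ hline q (Finset.mem_filter.1 hq).2)
      (fun q hq ↦ hf q (Finset.mem_filter.1 hq).1) (hfd.trans_lt (hL ℓ hℓ))
  have hpd (i) : pderiv i f = 0 := by
    by_contra h
    refine h (hmin _ (fun p hp ↦ hgrad p hp i) (totalDegree_pderiv_lt hdeg0 i))
  obtain ⟨g, k, rfl, hgdeg⟩ := exists_pow_eq_totalDegree_lt hpd hdeg0
  have hg0 : g = 0 := hmin g (fun q hq ↦ eq_zero_of_pow_eq_zero (by simpa using hf q hq)) hgdeg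
  rw [hg0] at hgdeg hf0 hdeg0
  by_cases hk : k = 0 <;> simp_all

open Classical in
theorem IsJoint.card_le_mul {K : Type*} [Field K] [PerfectField K] {n d : ℕ}
    {L : Finset (Set (Fin n → K))} {J : Finset (Fin n → K)}
    (hjoint : ∀ p ∈ J, IsJoint L p) (hcard : J.card < (n + d).choose d) :
    J.card ≤ L.card * d := by
  induction h : L.card generalizing L J with
  | zero =>
    by_contra! hJ
    obtain ⟨ℓ, hℓ, -⟩ := exists_card_filter_le (Finset.card_pos.1 (by omega)) hjoint hcard
    simp_all
  | succ N ih =>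
    obtain rfl | hJ := J.eq_empty_or_nonempty
    · simp
    obtain ⟨ℓ, hℓ, hle⟩ := exists_card_filter_le hJ hjoint hcard
    have hrest : {p ∈ J | p ∉ ℓ}.card ≤ N * d := by
      refine ih (L := L.erase ℓ) (fun p hp ↦ ?_)
        ((Finset.card_filter_le _ _).trans_lt hcard) (by rw [Finset.card_erase_of_mem hℓ, h]; rfl)
      rw [Finset.mem_filter] at hp
      obtain ⟨v, hv, hvL⟩ := hjoint p hp.1
      refine ⟨v, hv, fun i ↦ ?_⟩
      obtain ⟨m, hm, hpm, hline⟩ := hvL i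
      exact ⟨m, Finset.mem_erase.2 ⟨fun h ↦ hp.2 (h ▸ hpm), hm⟩, hpm, hline⟩
    have := Finset.card_filter_add_card_filter_not (s := J) (· ∈ ℓ)
    rw [add_mul]
    omega

theorem Nat.exists_lt_choose_pow_le_factorial_mul {n : ℕ} (hn : n ≠ 0) (k : ℕ) :
    ∃ d, k < (n + d).choose d ∧ d ^ n ≤ n.factorial * k := by
  have hex : ∃ d, k < (n + d).choose d := by
    refine ⟨k, ?_⟩
    calc k < (1 + k).choose k := by simp [Nat.add_comm 1 k]
      _ ≤ (n + k).choose k := Nat.choose_le_choose k (by omega)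
  refine ⟨Nat.find hex, Nat.find_spec hex, ?_⟩
  rcases h : Nat.find hex with _ | e
  · simp [hn]
  have hle : (e + n).choose n ≤ k := by
    have := Nat.find_min hex (m := e) (by omega)
    rwa [not_lt, Nat.add_comm, Nat.choose_symm_add] at this
  calc (e + 1) ^ n ≤ (e + 1).ascFactorial n := Nat.pow_succ_le_ascFactorial _ _
    _ = n.factorial * (e + n).choose n := Nat.ascFactorial_eq_factorial_mul_choose _ _
    _ ≤ n.factorial * k := Nat.mul_le_mul_left _ hle

theorem Nat.factorial_le_pow_sub_one (n : ℕ) : n.factorial ≤ n ^ (n - 1) := by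
  cases n with
  | zero => simp
  | succ n =>
    rw [Nat.add_sub_cancel]
    induction n with
    | zero => simp
    | succ n ih =>
      rw [Nat.factorial_succ, pow_succ']
      exact Nat.mul_le_mul_left _ (ih.trans (Nat.pow_le_pow_left (Nat.le_succ _) n))

theorem IsJoint.card_pow_le {K : Type*} [Field K] [PerfectField K] {n : ℕ} (hn : 2 ≤ n)
    {L : Finset (Set (Fin n → K))} {J : Finset (Fin n → K)}
    (hjoint : ∀ p ∈ J, IsJoint L p) :
    J.card ^ (n - 1) ≤ n ^ (n - 1) * L.card ^ n := by
  obtain ⟨d, hd, hdn⟩ := Nat.exists_lt_choose_pow_le_factorial_mul (by omega : n ≠ 0) J.card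
  obtain hJ | hJ := Nat.eq_zero_or_pos J.card
  · simp [hJ, Nat.sub_ne_zero_of_lt hn]
  refine Nat.le_of_mul_le_mul_right ?_ hJ
  calc J.card ^ (n - 1) * J.card = J.card ^ n := pow_sub_one_mul (by omega) _
    _ ≤ (L.card * d) ^ n := Nat.pow_le_pow_left (card_le_mul hjoint hd) _
    _ = L.card ^ n * d ^ n := mul_pow ..
    _ ≤ L.card ^ n * (n ^ (n - 1) * J.card) :=
      Nat.mul_le_mul_left _ (hdn.trans (Nat.mul_le_mul_right _ n.factorial_le_pow_sub_one))
    _ = n ^ (n - 1) * L.card ^ n * J.card := by ring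

theorem Set.finite_and_ncard_le_of_forall_card_le {α : Type*} {s : Set α} {r : ℝ}
    (h : ∀ t : Finset α, ↑t ⊆ s → (t.card : ℝ) ≤ r) : s.Finite ∧ (s.ncard : ℝ) ≤ r := by
  have hs : s.Finite := by
    by_contra hs
    obtain ⟨t, hts, ht⟩ := Set.Infinite.exists_subset_card_eq hs (⌊r⌋₊ + 1)
    have := h t hts
    rw [ht] at this
    exact absurd this (by push_cast; exact not_le.2 (Nat.lt_floor_add_one r))
  refine ⟨hs, ?_⟩
  rw [Set.ncard_eq_toFinset_card s hs]
  exact h _ (by simp)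

theorem LinearIndependent.algebraMap_comp {F K : Type*} [Field F] [Field K] [Algebra F K] {n : ℕ}
    {v : Fin n → Fin n → F} (hv : LinearIndependent F v) :
    LinearIndependent K fun i j ↦ algebraMap F K (v i j) := by
  have h : IsUnit (Matrix.of v) := Matrix.linearIndependent_rows_iff_isUnit.1 hv
  exact Matrix.linearIndependent_rows_iff_isUnit.2 (h.map (algebraMap F K).mapMatrix)

/-- **Joints theorem** (Theorem 3.3). -/
theorem joints (F : Type*) [Field F] (n : ℕ) (hn : 2 ≤ n)
    (L : Finset (Set (Fin n → F)))
    (hL : ∀ ℓ ∈ L, ∃ (x v : Fin n → F), v ≠ 0 ∧ ℓ = {y | ∃ t : F, y = x + t • v}) :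
    {p : Fin n → F | ∃ v : Fin n → (Fin n → F), LinearIndependent F v ∧
        ∀ i, {y | ∃ t : F, y = p + t • v i} ∈ L}.Finite ∧
      ({p : Fin n → F | ∃ v : Fin n → (Fin n → F), LinearIndependent F v ∧
        ∀ i, {y | ∃ t : F, y = p + t • v i} ∈ L}.ncard : ℝ) ≤
        n * (L.card : ℝ) ^ ((n : ℝ) / ((n : ℝ) - 1)) := by
  classical
  refine Set.finite_and_ncard_le_of_forall_card_le fun J hJ ↦ ?_
  let φ : (Fin n → F) → Fin n → AlgebraicClosure F := fun p i ↦ algebraMap F _ (p i)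
  have hφ : Function.Injective φ := fun p q h ↦
    funext fun i ↦ (algebraMap F (AlgebraicClosure F)).injective (congrFun h i)
  have hjoint : ∀ p ∈ J.image φ, IsJoint (L.image (φ '' ·)) p := by
    rw [Finset.forall_mem_image]
    intro p hp
    obtain ⟨v, hv, hvL⟩ := hJ hp
    refine ⟨fun i ↦ φ (v i), hv.algebraMap_comp, fun i ↦
      ⟨_, Finset.mem_image_of_mem _ (hvL i), ⟨p, ⟨0, by simp⟩, rfl⟩, ?_⟩⟩
    rintro _ ⟨_, ⟨t, rfl⟩, rfl⟩
    exact ⟨algebraMap F _ t, by ext; simp [φ, Algebra.smul_def]⟩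
  have hpow : J.card ^ (n - 1) ≤ n ^ (n - 1) * L.card ^ n := by
    have h := IsJoint.card_pow_le hn hjoint
    rw [Finset.card_image_of_injective _ hφ] at h
    exact h.trans (by gcongr; exact Finset.card_image_le)
  have hn1 : (n : ℝ) - 1 ≠ 0 := by
    have : (2 : ℝ) ≤ n := by exact_mod_cast hn
    linarith
  refine le_of_pow_le_pow_left₀ (n := n - 1) (by omega) (by positivity) ?_
  rw [mul_pow, ← Real.rpow_natCast (_ ^ _), ← Real.rpow_mul (by positivity),
    Nat.cast_sub (by omega), Nat.cast_one, div_mul_cancel₀ _ hn1, Real.rpow_natCast]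
  exact_mod_cast hpow
end

section
/- There exists an absolute constant C > 0 with the following property: for every finite field F of odd cardinality q and every polynomial f ∈ F[x] of degree 3, the number N of points (x, y) ∈ F² with y² = f(x) satisfies |N − q| ≤ C·√q. -/
namespace Stepanov

open Polynomial

theorem pow_sub_dvd_hasseDeriv_pow_mul {R : Type*} [CommRing R] (f u : R[X]) (n k : ℕ) :
    f ^ (n - k) ∣ hasseDeriv k (f ^ n * u) := by
  induction n generalizing k with
  | zero => simp
  | succ n ih =>
    rw [pow_succ', mul_assoc, hasseDeriv_mul]
    refine Finset.dvd_sum fun ij hij => ?_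
    obtain ⟨i, j⟩ := ij
    replace hij : i + j = k := Finset.HasAntidiagonal.mem_antidiagonal.1 hij
    change _ ∣ hasseDeriv i f * hasseDeriv j (f ^ n * u)
    rcases Nat.eq_zero_or_pos i with rfl | hi
    · rw [hasseDeriv_zero']
      refine (pow_dvd_pow f (by lia : n + 1 - k ≤ (n - j) + 1)).trans ?_
      rw [pow_succ']
      exact mul_dvd_mul_left _ (ih j)
    · exact ((pow_dvd_pow f (by lia : n + 1 - k ≤ n - j)).trans (ih j)).mul_left _

theorem exists_hasseDeriv_pow_mul_eq {F : Type*} [Field F] {f : F[X]} (hf : f ≠ 0)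
    (c l : ℕ) {k : ℕ} (hk : k ≤ l) :
    ∃ L : F[X] →ₗ[F] F[X], ∀ u, hasseDeriv k (f ^ (c + l) * u) = f ^ c * L u ∧
      (L u).natDegree ≤ l * f.natDegree + u.natDegree := by
  have hd (u : F[X]) : ∃ v, hasseDeriv k (f ^ (c + l) * u) = f ^ c * v :=
    (pow_dvd_pow f (by lia)).trans (pow_sub_dvd_hasseDeriv_pow_mul f u (c + l) k)
  choose L hL using hd
  have hc : f ^ c ≠ 0 := pow_ne_zero _ hf
  refine ⟨⟨⟨L, fun u v => ?_⟩, fun a u => ?_⟩, fun u => ⟨hL u, ?_⟩⟩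
  · apply mul_left_cancel₀ hc
    rw [← hL, mul_add, mul_add, map_add, hL, hL]
  · apply mul_left_cancel₀ hc
    rw [← hL, mul_smul_comm, map_smul, hL, RingHom.id_apply, mul_smul_comm]
  · change (L u).natDegree ≤ _
    rcases eq_or_ne (L u) 0 with h0 | h0
    · simp [h0]
    have h1 := natDegree_hasseDeriv_le (f ^ (c + l) * u) k
    rw [hL, natDegree_mul hc h0, natDegree_pow] at h1
    have h2 := (natDegree_mul_le (p := f ^ (c + l)) (q := u))
    rw [natDegree_pow] at h2
    have := Nat.sub_le (natDegree (f ^ (c + l) * u)) k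
    rw [add_mul] at h2
    lia

theorem exists_ne_zero_sum_eq_zero {F : Type*} [Field F] {J d l D e m : ℕ} (Y : F[X])
    (hY : Y.natDegree ≤ m) (M N : Fin l → F[X] →ₗ[F] F[X])
    (hM : ∀ k u, (M k u).natDegree ≤ e + u.natDegree)
    (hN : ∀ k u, (N k u).natDegree ≤ e + u.natDegree)
    (hD : J * m + e + d ≤ D) (hcard : l * D < 2 * (J * d)) :
    ∃ A B : Fin J → F[X], (∀ j, (A j).degree < d) ∧ (∀ j, (B j).degree < d) ∧
      (A ≠ 0 ∨ B ≠ 0) ∧ ∀ k, ∑ j : Fin J, Y ^ (j : ℕ) * (M k (A j) + N k (B j)) = 0 := by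
  have hdeg (j : Fin J) (u v : degreeLT F d) (k : Fin l) :
      Y ^ (j : ℕ) * (M k u + N k v) ∈ degreeLT F D := by
    have hlt (u : degreeLT F d) : (u : F[X]).natDegree < d := by
      have := mem_degreeLT.1 u.2
      have hd : d ≠ 0 := by rintro rfl; simp at hcard
      rcases eq_or_ne (u : F[X]) 0 with h | h
      · rw [h, natDegree_zero]; lia
      · rwa [natDegree_lt_iff_degree_lt h]
    rw [mem_degreeLT]
    have h1 := hlt u
    have h2 := hlt v
    have h3 := hM k u
    have h4 := hN k v
    have h5 : (Y ^ (j : ℕ)).natDegree ≤ J * m :=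
      natDegree_pow_le.trans (Nat.mul_le_mul j.2.le hY)
    have h6 := natDegree_add_le (M k u) (N k v)
    have h7 := natDegree_mul_le (p := Y ^ (j : ℕ)) (q := M k u + N k v)
    refine degree_le_natDegree.trans_lt ?_
    rw [Nat.cast_lt]
    lia
  let Φ : ((Fin J → degreeLT F d) × (Fin J → degreeLT F d)) →ₗ[F] (Fin l → degreeLT F D) :=
    { toFun := fun p k => ⟨∑ j : Fin J, Y ^ (j : ℕ) * (M k (p.1 j) + N k (p.2 j)),
        Submodule.sum_mem _ fun j _ => hdeg j _ _ k⟩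
      map_add' := fun p p' => by
        ext1 k
        apply Subtype.ext
        simp only [Prod.fst_add, Prod.snd_add, Pi.add_apply, Submodule.coe_add, map_add,
          ← Finset.sum_add_distrib]
        exact Finset.sum_congr rfl fun j _ => by ring
      map_smul' := fun a p => by
        ext1 k
        apply Subtype.ext
        simp only [Prod.smul_fst, Prod.smul_snd, Pi.smul_apply, Submodule.coe_smul, map_smul,
          RingHom.id_apply, Finset.smul_sum, ← smul_add, mul_smul_comm] }
  have hfin (n : ℕ) : Module.finrank F (degreeLT F n) = n := by
    rw [(degreeLTEquiv F n).finrank_eq, Module.finrank_fin_fun]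
  have hff (n : ℕ) : FiniteDimensional F (degreeLT F n) :=
    (degreeLTEquiv F n).symm.finiteDimensional
  have hker : LinearMap.ker Φ ≠ ⊥ := by
    apply LinearMap.ker_ne_bot_of_finrank_lt
    rw [Module.finrank_prod, Module.finrank_pi_fintype, Module.finrank_pi_fintype]
    simp only [hfin, Finset.sum_const, Finset.card_univ, Fintype.card_fin, smul_eq_mul]
    lia
  obtain ⟨⟨A, B⟩, hp, hne⟩ := Submodule.exists_mem_ne_zero_of_ne_bot hker
  refine ⟨fun j => A j, fun j => B j, fun j => mem_degreeLT.1 (A j).2,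
    fun j => mem_degreeLT.1 (B j).2, ?_, fun k => ?_⟩
  · by_contra! h
    apply hne
    ext j : 3
    · exact congrFun h.1 j
    · exact congrFun h.2 j
  · exact congrArg Subtype.val (congrFun (LinearMap.mem_ker.1 hp) k)

theorem X_sub_C_pow_dvd_of_hasseDeriv_eval_eq_zero {R : Type*} [CommRing R] {p : R[X]} {x : R}
    {l : ℕ} (hp : ∀ k < l, (hasseDeriv k p).eval x = 0) : (X - C x) ^ l ∣ p := by
  rw [X_sub_C_pow_dvd_iff, ← taylor_apply, X_pow_dvd_iff]
  intro k hk
  rw [taylor_coeff, hp k hk]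

section Finite

variable {F : Type*} [Field F] [Fintype F]

theorem pow_card_sub_C (f : F[X]) (v : F) :
    (f - C v) ^ Fintype.card F = f ^ Fintype.card F - C v := by
  rw [← FiniteField.expand_card, map_sub, expand_C, FiniteField.expand_card]

theorem eq_zero_of_pow_card_dvd {f A B : F[X]} {h : ℕ} {b : F}
    (hq : Fintype.card F = 2 * h + 1) (hb : f.eval b ≠ 0) (hodd : Odd f.natDegree)
    (hA : 2 * A.natDegree + f.natDegree < Fintype.card F)
    (hB : 2 * B.natDegree < Fintype.card F)
    (hdvd : (X - C b) ^ Fintype.card F ∣ A + f ^ h * B) : A = 0 ∧ B = 0 := by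
  have hf : f ≠ 0 := by rintro rfl; simp at hb
  have h1 : (X - C b) ^ Fintype.card F ∣ f ^ Fintype.card F - C (f.eval b) := by
    rw [← pow_card_sub_C]
    exact pow_dvd_pow_of_dvd (X_sub_C_dvd_sub_C_eval) _
  have h2 : (X - C b) ^ Fintype.card F ∣ A ^ 2 * f - C (f.eval b) * B ^ 2 := by
    have : A ^ 2 * f - C (f.eval b) * B ^ 2 =
        (A + f ^ h * B) * (f * (A - f ^ h * B)) +
          (f ^ Fintype.card F - C (f.eval b)) * B ^ 2 := by
      rw [hq]; ring
    rw [this]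
    exact dvd_add (hdvd.mul_right _) (h1.mul_right _)
  have h3 : A ^ 2 * f - C (f.eval b) * B ^ 2 = 0 := by
    refine eq_zero_of_dvd_of_natDegree_lt h2 ?_
    rw [natDegree_pow, natDegree_X_sub_C, mul_one]
    refine (natDegree_sub_le _ _).trans_lt (max_lt ?_ ?_)
    · have := natDegree_mul_le (p := A ^ 2) (q := f)
      rw [natDegree_pow] at this
      lia
    · rw [natDegree_C_mul hb, natDegree_pow]
      exact hB
  have h4 := sub_eq_zero.1 h3
  have hA0 : A = 0 := by
    by_contra hA0
    have hB0 : B ≠ 0 := by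
      rintro rfl
      simp [hA0, hf] at h4
    have h5 := congrArg natDegree h4
    rw [natDegree_C_mul hb, natDegree_mul (pow_ne_zero _ hA0) hf, natDegree_pow,
      natDegree_pow] at h5
    obtain ⟨t, ht⟩ := hodd
    lia
  subst hA0
  simpa [hb] using h4

theorem eq_zero_of_sum_eq_zero {f : F[X]} {h : ℕ} {b : F}
    (hq : Fintype.card F = 2 * h + 1) (hb : f.eval b ≠ 0) (hodd : Odd f.natDegree) (J : ℕ)
    (A B : Fin J → F[X])
    (hA : ∀ j, 2 * (A j).natDegree + f.natDegree < Fintype.card F)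
    (hB : ∀ j, 2 * (B j).natDegree < Fintype.card F)
    (hsum : ∑ j : Fin J, (X - C b) ^ (Fintype.card F * (j : ℕ)) * (A j + f ^ h * B j) = 0) :
    A = 0 ∧ B = 0 := by
  induction J with
  | zero => exact ⟨Subsingleton.elim _ _, Subsingleton.elim _ _⟩
  | succ J ih =>
    have hY : (X - C b) ^ Fintype.card F ≠ 0 := pow_ne_zero _ (X_sub_C_ne_zero b)
    have hstep : ∑ j : Fin J, (X - C b) ^ (Fintype.card F * (j.succ : ℕ)) *
          (A j.succ + f ^ h * B j.succ) =
        (X - C b) ^ Fintype.card F * ∑ j : Fin J, (X - C b) ^ (Fintype.card F * (j : ℕ)) *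
          (A j.succ + f ^ h * B j.succ) := by
      rw [Finset.mul_sum]
      refine Finset.sum_congr rfl fun j _ => ?_
      rw [Fin.val_succ, Nat.mul_succ, pow_add, mul_comm ((X - C b) ^ _), mul_assoc]
    rw [Fin.sum_univ_succ, hstep, Fin.val_zero, mul_zero, pow_zero, one_mul] at hsum
    obtain ⟨hA0, hB0⟩ := eq_zero_of_pow_card_dvd hq hb hodd (hA 0) (hB 0)
      ((dvd_add_left (dvd_mul_right _ _)).1 (hsum ▸ dvd_zero _))
    rw [hA0, hB0, mul_zero, add_zero, zero_add] at hsum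
    obtain ⟨hA1, hB1⟩ := ih (fun j => A j.succ) (fun j => B j.succ) (fun j => hA _)
      (fun j => hB _) ((mul_eq_zero.1 hsum).resolve_left hY)
    refine ⟨funext fun j => ?_, funext fun j => ?_⟩
    · exact Fin.cases hA0 (congrFun hA1) j
    · exact Fin.cases hB0 (congrFun hB1) j

theorem X_sub_C_pow_dvd_pow_card_mul_sub (x b : F) {l : ℕ} (hl : l ≤ Fintype.card F) (j : ℕ) :
    (X - C x) ^ l ∣ (X - C b) ^ (Fintype.card F * (j : ℕ)) - C (x - b) ^ j := by
  refine (pow_dvd_pow _ hl).trans ?_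
  rw [pow_mul]
  refine dvd_trans (Eq.dvd ?_) (sub_dvd_pow_sub_pow _ _ j)
  rw [pow_card_sub_C, pow_card_sub_C, C_sub]
  ring

/-- The auxiliary polynomial of Stepanov's method bounds the number of points at which
`f ^ ((q - 1) / 2)` takes a given value. -/
theorem card_mul_le {f : F[X]} {h J d l : ℕ} {b : F}
    (hq : Fintype.card F = 2 * h + 1) (hb : f.eval b ≠ 0) (hodd : Odd f.natDegree)
    (hl : l ≤ Fintype.card F) (hd : 2 * d + f.natDegree ≤ Fintype.card F + 1)
    (hcard : l * (J + l * f.natDegree + d) < 2 * (J * d)) (a : F) (S : Finset F)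
    (hS : ∀ x ∈ S, f.eval x ^ h = a) :
    S.card * l ≤ Fintype.card F * J + (h + l) * f.natDegree + d := by
  have hf : f ≠ 0 := by rintro rfl; simp at hb
  choose M hM using fun k : Fin l => exists_hasseDeriv_pow_mul_eq hf 0 l k.2.le
  choose N hN using fun k : Fin l => exists_hasseDeriv_pow_mul_eq hf h l k.2.le
  obtain ⟨A, B, hA, hB, hne, hsum⟩ := exists_ne_zero_sum_eq_zero (J := J) (d := d) (m := 1)
    (X - C b) (natDegree_X_sub_C b).le M (fun k => a • N k) (fun k u => (hM k u).2)
    (fun k u => (natDegree_smul_le _ _).trans (hN k u).2) (by rw [mul_one]) hcard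
  have hd0 : d ≠ 0 := by rintro rfl; simp at hcard
  have hlt (u : F[X]) (hu : u.degree < d) : u.natDegree + 1 ≤ d := by
    rcases eq_or_ne u 0 with h | h
    · rw [h, natDegree_zero]; lia
    · exact (natDegree_lt_iff_degree_lt h).2 hu
  obtain ⟨t, ht⟩ := hodd
  have hr : ∑ j : Fin J, (X - C b) ^ (Fintype.card F * (j : ℕ)) * (A j + f ^ h * B j) ≠ 0 := by
    intro h0
    obtain ⟨h1, h2⟩ := eq_zero_of_sum_eq_zero hq hb ⟨t, ht⟩ J A B
      (fun j => by have := hlt _ (hA j); lia) (fun j => by have := hlt _ (hB j); lia) h0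
    exact hne.elim (· h1) (· h2)
  set r := f ^ l * ∑ j : Fin J, (X - C b) ^ (Fintype.card F * (j : ℕ)) * (A j + f ^ h * B j)
    with hrdef
  have hr0 : r ≠ 0 := mul_ne_zero (pow_ne_zero _ hf) hr
  have hx (x : F) (hx : x ∈ S) : (X - C x) ^ l ∣ r := by
    have hr' : r = ∑ j : Fin J, ((X - C b) ^ (Fintype.card F * (j : ℕ)) - C (x - b) ^ (j : ℕ)) *
          (f ^ l * (A j + f ^ h * B j)) +
        ∑ j : Fin J, ((x - b) ^ (j : ℕ)) • (f ^ (0 + l) * A j + f ^ (h + l) * B j) := by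
      rw [hrdef, Finset.mul_sum, ← Finset.sum_add_distrib]
      refine Finset.sum_congr rfl fun j _ => ?_
      rw [smul_eq_C_mul, zero_add, pow_add, C_pow]
      ring
    rw [hr']
    refine dvd_add (Finset.dvd_sum fun j _ =>
      (X_sub_C_pow_dvd_pow_card_mul_sub x b hl j).mul_right _) ?_
    refine X_sub_C_pow_dvd_of_hasseDeriv_eval_eq_zero fun k hk => ?_
    have h1 := congrArg (eval x) (hsum ⟨k, hk⟩)
    rw [eval_zero, eval_finsetSum] at h1
    rw [map_sum, eval_finsetSum, ← h1]
    refine Finset.sum_congr rfl fun j _ => ?_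
    have h2 := (hM ⟨k, hk⟩ (A j)).1
    have h3 := (hN ⟨k, hk⟩ (B j)).1
    simp only at h2 h3
    rw [map_smul, map_add, h2, h3]
    simp only [pow_zero, one_mul, smul_eq_C_mul, LinearMap.smul_apply, eval_mul, eval_add,
      eval_C, eval_pow, eval_sub, eval_X, hS x hx]
  have hprod : ∏ x ∈ S, (X - C x) ^ l ∣ r :=
    Finset.prod_dvd_of_coprime (fun x _ y _ hxy =>
      (isCoprime_X_sub_C_of_isUnit_sub (sub_ne_zero.2 hxy).isUnit).pow) hx
  have h1 := natDegree_le_of_dvd hprod hr0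
  rw [natDegree_prod_of_monic _ _ fun x _ => (monic_X_sub_C x).pow l] at h1
  simp only [natDegree_pow, natDegree_X_sub_C, mul_one, Finset.sum_const, smul_eq_mul] at h1
  have h2 : r.natDegree ≤ l * f.natDegree +
      (Fintype.card F * J + (d + h * f.natDegree)) := by
    refine natDegree_mul_le.trans (Nat.add_le_add (natDegree_pow_le) ?_)
    refine natDegree_sum_le_of_forall_le _ _ fun j _ => ?_
    refine natDegree_mul_le.trans (Nat.add_le_add ?_ ?_)
    · rw [natDegree_pow, natDegree_X_sub_C, mul_one]
      exact Nat.mul_le_mul_left _ j.2.le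
    · have h3 := hlt _ (hA j)
      have h4 := hlt _ (hB j)
      have h5 := natDegree_mul_le (p := f ^ h) (q := B j)
      have h6 := natDegree_pow_le (p := f) (n := h)
      have h7 := natDegree_add_le (A j) (f ^ h * B j)
      lia
  rw [add_mul]
  lia

theorem card_le_of_natDegree_eq_three {f : F[X]} {h t : ℕ} (hq : Fintype.card F = 2 * h + 1)
    (hf : f.natDegree = 3) (ht : t = Nat.sqrt (h - 1)) (ht9 : 9 ≤ t) (a : F) (S : Finset F)
    (hS : ∀ x ∈ S, f.eval x ^ h = a) :
    (S.card : ℝ) ≤ Fintype.card F / 2 + 10 * √(Fintype.card F) + 3 := by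
  have hd1 : t * t ≤ h - 1 := ht ▸ Nat.sqrt_le (h - 1)
  have hd2 : h - 1 < (t + 1) * (t + 1) := ht ▸ Nat.lt_succ_sqrt (h - 1)
  obtain ⟨d, rfl⟩ : ∃ d, h = d + 1 := by
    have : 0 < h - 1 := by nlinarith
    exact ⟨h - 1, by lia⟩
  rw [Nat.add_sub_cancel] at hd1 hd2
  obtain ⟨b, hb⟩ : ∃ b, f.eval b ≠ 0 := by
    by_contra! h0
    have hf0 : f = 0 := eq_zero_of_natDegree_lt_card_of_eval_eq_zero f
      Function.injective_id h0 (by rw [hf, hq]; nlinarith)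
    simp [hf0] at hf
  have key := card_mul_le (J := t + 8) (d := d) (l := 2 * t) hq hb (hf ▸ by decide)
    (by nlinarith) (by lia) (by rw [hf]; nlinarith) a S hS
  rw [hf] at key
  have hqR : (Fintype.card F : ℝ) = 2 * d + 3 := by rw [hq]; push_cast; ring
  have keyR : (S.card : ℝ) * (2 * t) ≤
      Fintype.card F * (t + 8) + (d + 1 + 2 * t) * 3 + d := by exact_mod_cast key
  set q : ℝ := (Fintype.card F : ℝ)
  have htR : (9 : ℝ) ≤ t := by exact_mod_cast ht9
  have hd2R : (d : ℝ) + 1 ≤ (t + 1) * (t + 1) := by exact_mod_cast hd2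
  have hsq : √q ≤ 2 * t := Real.sqrt_le_iff.2 ⟨by positivity, by nlinarith⟩
  have hmul : √q * √q = q := Real.mul_self_sqrt (by positivity)
  have h0 := Real.sqrt_nonneg q
  have h1 : q ≤ 2 * t * √q := by nlinarith
  refine le_of_mul_le_mul_right ?_ (by positivity : (0 : ℝ) < 2 * t)
  nlinarith

theorem ncard_sq_sub_card [DecidableEq F] (hF : ringChar F ≠ 2) (g : F → F) :
    ({xy : F × F | xy.2 ^ 2 = g xy.1}.ncard : ℤ) - Fintype.card F =
      ∑ x, quadraticChar F (g x) := by
  have h1 : {xy : F × F | xy.2 ^ 2 = g xy.1}.ncard =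
      ∑ x, {y : F | y ^ 2 = g x}.toFinset.card := by
    rw [← Finset.card_sigma, Set.ncard_eq_toFinset_card']
    refine Finset.card_bij' (fun p _ => ⟨p.1, p.2⟩) (fun p _ => (p.1, p.2)) ?_ ?_ ?_ ?_ <;> simp
  rw [h1, Nat.cast_sum, Finset.sum_congr rfl fun x _ => quadraticChar_card_sqrts hF (g x),
    Finset.sum_add_distrib]
  simp

theorem sum_quadraticChar [DecidableEq F] (g : F → F) :
    ∑ x, quadraticChar F (g x) =
      ((Finset.univ.filter fun x => quadraticChar F (g x) = 1).card : ℤ) -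
      (Finset.univ.filter fun x => quadraticChar F (g x) = -1).card := by
  rw [Finset.card_filter, Finset.card_filter, Nat.cast_sum, Nat.cast_sum,
    ← Finset.sum_sub_distrib]
  refine Finset.sum_congr rfl fun x _ => ?_
  rcases eq_or_ne (g x) 0 with h | h
  · simp [h]
  · rcases quadraticChar_dichotomy h with h | h <;> simp [h]

theorem card_le_card_quadraticChar_add_three [DecidableEq F] {f : F[X]} (hf : f.natDegree = 3) :
    Fintype.card F ≤ (Finset.univ.filter fun x => quadraticChar F (f.eval x) = 1).card +
      (Finset.univ.filter fun x => quadraticChar F (f.eval x) = -1).card + 3 := by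
  have hf0 : f ≠ 0 := by rintro rfl; simp at hf
  have hroots : f.roots.toFinset.card ≤ 3 :=
    (Multiset.toFinset_card_le _).trans (hf ▸ card_roots' f)
  refine le_trans ?_ (Nat.add_le_add_left hroots _)
  rw [← Finset.card_univ]
  refine le_trans (Finset.card_le_card fun x _ => ?_)
    ((Finset.card_union_le _ _).trans (Nat.add_le_add_right (Finset.card_union_le _ _) _))
  rcases eq_or_ne (f.eval x) 0 with h | h
  · simp [h, hf0]
  · rcases quadraticChar_dichotomy h with h | h <;>
      simp only [Finset.mem_union, Finset.mem_filter, h, Finset.mem_univ, true_and, true_or, or_true]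

end Finite
end Stepanov

/-- **Hasse bound** (Proposition 4.4). -/
theorem hasse_bound : ∃ C : ℝ, 0 < C ∧ ∀ (F : Type) [Field F] [Fintype F],
    Odd (Fintype.card F) → ∀ f : Polynomial F, f.natDegree = 3 →
      |({xy : F × F | xy.2 ^ 2 = f.eval xy.1}.ncard : ℝ) - (Fintype.card F : ℝ)| ≤
        C * Real.sqrt (Fintype.card F) := by
  classical
  refine ⟨30, by norm_num, fun F _ _ hodd f hf => ?_⟩
  obtain ⟨h, hq⟩ := hodd
  have hF : ringChar F ≠ 2 := fun h2 => by
    have := FiniteField.even_card_of_char_two h2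
    lia
  have hN := Stepanov.ncard_sq_sub_card hF fun x => f.eval x
  rw [Stepanov.sum_quadraticChar] at hN
  have hZ := Stepanov.card_le_card_quadraticChar_add_three hf
  have hval (a : ℤ) (x : F)
      (hx : x ∈ Finset.univ.filter fun x => quadraticChar F (f.eval x) = a) :
      f.eval x ^ h = (a : F) := by
    rw [← (Finset.mem_filter.1 hx).2, quadraticChar_eq_pow_of_char_ne_two' hF, hq]
    congr 1
    lia
  have hle (a : ℤ) : (Finset.univ.filter fun x => quadraticChar F (f.eval x) = a).card ≤
      Fintype.card F := Finset.card_le_univ _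
  have hle1 := hle 1
  have hle2 := hle (-1)
  have hval1 := fun ht => Stepanov.card_le_of_natDegree_eq_three hq hf rfl ht _ _ (hval 1)
  have hval2 := fun ht => Stepanov.card_le_of_natDegree_eq_three hq hf rfl ht _ _ (hval (-1))
  generalize (Finset.univ.filter fun x => quadraticChar F (f.eval x) = 1).card = s at *
  generalize (Finset.univ.filter fun x => quadraticChar F (f.eval x) = -1).card = s' at *
  have hNR : ({xy : F × F | xy.2 ^ 2 = f.eval xy.1}.ncard : ℝ) - Fintype.card F = s - s' := by
    exact_mod_cast hN
  rw [hNR]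
  have h1 : (1 : ℝ) ≤ Fintype.card F := by exact_mod_cast Fintype.card_pos
  have hmul : √(Fintype.card F : ℝ) * √(Fintype.card F : ℝ) = Fintype.card F :=
    Real.mul_self_sqrt (by positivity)
  have h1' : 1 ≤ √(Fintype.card F : ℝ) := Real.one_le_sqrt.2 h1
  have hle1R : (s : ℝ) ≤ Fintype.card F := by exact_mod_cast hle1
  have hle2R : (s' : ℝ) ≤ Fintype.card F := by exact_mod_cast hle2
  have hZR : (Fintype.card F : ℝ) ≤ s + s' + 3 := by exact_mod_cast hZ
  rw [abs_le]
  rcases le_or_gt 9 (Nat.sqrt (h - 1)) with ht | ht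
  · have h2 := hval1 ht
    have h3 := hval2 ht
    constructor <;> linarith
  · have h4 := Nat.sqrt_lt.1 ht
    have h5 : (Fintype.card F : ℝ) ≤ 900 := by
      have : Fintype.card F ≤ 900 := by lia
      exact_mod_cast this
    have h6 : √(Fintype.card F : ℝ) ≤ 30 := Real.sqrt_le_iff.2 ⟨by norm_num, by linarith⟩
    have h7 : (Fintype.card F : ℝ) ≤ 30 * √(Fintype.card F : ℝ) := by nlinarith
    constructor <;> linarith [(Nat.cast_nonneg s : (0 : ℝ) ≤ s),
      (Nat.cast_nonneg s' : (0 : ℝ) ≤ s')]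
end

section
/- Let n ≥ 1 be an integer, let d ≥ 0, and let E₁,…,E_m be finite subsets of ℝⁿ with m < C(d+n, n). Then there exists a non-zero polynomial P ∈ ℝ[x₁,…,xₙ] of total degree at most d which bisects each Eᵢ, in the sense that for each 1 ≤ i ≤ m, both |{x ∈ Eᵢ : P(x) > 0}| ≤ |Eᵢ|/2 and |{x ∈ Eᵢ : P(x) < 0}| ≤ |Eᵢ|/2. -/
theorem Polynomial.exists_isRoot_of_odd_natDegree_real (p : Polynomial ℝ) (hp : Odd p.natDegree) :
    ∃ x, p.IsRoot x := by
  induction hn : p.natDegree using Nat.strong_induction_on generalizing p with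
  | _ n ih =>
    have hp0 : p ≠ 0 := by rintro rfl; simp at hp
    have hpu : ¬ IsUnit p := fun h => by
      rw [Polynomial.natDegree_eq_zero_of_isUnit h] at hp; simp at hp
    obtain ⟨q, hq, r, rfl⟩ := WfDvdMonoid.exists_irreducible_factor hpu hp0
    have hq0 := hq.ne_zero
    have hr0 : r ≠ 0 := right_ne_zero_of_mul hp0
    have hd := hq.natDegree_le_two
    have hpos := hq.natDegree_pos
    rw [Polynomial.natDegree_mul hq0 hr0] at hp hn
    obtain h1 | h2 : q.natDegree = 1 ∨ q.natDegree = 2 := by omega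
    · obtain ⟨x, hx⟩ := Polynomial.exists_root_of_degree_eq_one
        ((Polynomial.degree_eq_iff_natDegree_eq hq0).2 h1)
      exact ⟨x, by simp [Polynomial.IsRoot.def.1 hx]⟩
    · have : Odd r.natDegree := by rw [h2] at hp; grind
      obtain ⟨x, hx⟩ := ih r.natDegree (by omega) r this rfl
      exact ⟨x, by simp [Polynomial.IsRoot.def.1 hx]⟩

theorem exists_algHom_real_of_odd_finrank {R : Type*} [CommRing R] [Algebra ℝ R]
    (hR : Odd (Module.finrank ℝ R)) : Nonempty (R →ₐ[ℝ] ℝ) := by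
  induction hn : Module.finrank ℝ R using Nat.strong_induction_on generalizing R with
  | _ n ih =>
    have hfin : Module.Finite ℝ R := Module.finite_of_finrank_pos hR.pos
    have hnt : Nontrivial R := Module.nontrivial_of_finrank_pos (R := ℝ) hR.pos
    by_cases hs : Function.Surjective (algebraMap ℝ R)
    · exact ⟨(AlgEquiv.ofBijective (Algebra.ofId ℝ R)
        ⟨(algebraMap ℝ R).injective, hs⟩).symm.toAlgHom⟩
    · simp only [Function.Surjective, not_forall, not_exists] at hs
      obtain ⟨x, hx⟩ := hs
      obtain ⟨c, hc⟩ := Polynomial.exists_isRoot_of_odd_natDegree_real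
        (LinearMap.mulLeft ℝ x).charpoly (by rwa [LinearMap.charpoly_natDegree])
      obtain ⟨w, hw⟩ :=
        ((Module.End.hasEigenvalue_iff_isRoot_charpoly _ c).2 hc).exists_hasEigenvector
      have hw0 := hw.2
      have hwc : x * w = c • w := hw.apply_eq_smul
      set y : R := x - algebraMap ℝ R c with hy
      have hy0 : y ≠ 0 := fun h => hx c (sub_eq_zero.1 h).symm
      have hyw : y * w = 0 := by rw [hy, sub_mul, hwc, Algebra.smul_def, sub_self]
      -- the principal ideal and the annihilator of `y` have complementary dimensions
      let K : Ideal R := LinearMap.ker (LinearMap.mulLeft R y)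
      let J : Ideal R := LinearMap.range (LinearMap.mulLeft R y)
      have hK : Module.finrank ℝ (R ⧸ K) = Module.finrank ℝ J :=
        ((LinearMap.mulLeft R y).quotKerEquivRange.restrictScalars ℝ).finrank_eq
      have hJ : Module.finrank ℝ (R ⧸ J) + Module.finrank ℝ J = Module.finrank ℝ R :=
        Submodule.finrank_quotient_add_finrank (J.restrictScalars ℝ)
      have hK' : Module.finrank ℝ (R ⧸ K) + Module.finrank ℝ K = Module.finrank ℝ R :=
        Submodule.finrank_quotient_add_finrank (K.restrictScalars ℝ)
      have hJpos : 0 < Module.finrank ℝ J := by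
        have : Nontrivial J := ⟨⟨⟨y, 1, by simp⟩, 0, fun h => hy0 (congrArg Subtype.val h)⟩⟩
        exact Module.finrank_pos
      have hKpos : 0 < Module.finrank ℝ K := by
        have : Nontrivial K := ⟨⟨⟨w, hyw⟩, 0, fun h => hw0 (congrArg Subtype.val h)⟩⟩
        exact Module.finrank_pos
      rcases Nat.even_or_odd (Module.finrank ℝ (R ⧸ J)) with hev | hodd
      · have : Odd (Module.finrank ℝ (R ⧸ K)) := by
          rw [hK]; rw [← hJ] at hR; grind
        obtain ⟨φ⟩ := ih _ (by omega) this rfl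
        exact ⟨φ.comp (Ideal.Quotient.mkₐ ℝ K)⟩
      · obtain ⟨φ⟩ := ih _ (by omega) hodd rfl
        exact ⟨φ.comp (Ideal.Quotient.mkₐ ℝ J)⟩

theorem exists_algHom_real_of_odd_finrank_quotient {R : Type*} [CommRing R] [Algebra ℝ R]
    (J : Ideal R) (hJ : Odd (Module.finrank ℝ (R ⧸ J))) :
    ∃ φ : R →ₐ[ℝ] ℝ, ∀ p ∈ J, φ p = 0 := by
  obtain ⟨φ⟩ := exists_algHom_real_of_odd_finrank hJ
  refine ⟨φ.comp (Ideal.Quotient.mkₐ ℝ J), fun p hp => ?_⟩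
  rw [AlgHom.comp_apply, Ideal.Quotient.mkₐ_eq_mk, Ideal.Quotient.eq_zero_iff_mem.2 hp, map_zero]

namespace MvPolynomial

section NormalForm

variable {σ : Type*}

/-- The polynomials all of whose monomials have degree less than `k`. -/
noncomputable def degreeLT (σ : Type*) (k : ℕ) : Submodule ℝ (MvPolynomial σ ℝ) :=
  restrictSupport ℝ {c | c.degree < k}

theorem mem_degreeLT {k : ℕ} {p : MvPolynomial σ ℝ} :
    p ∈ degreeLT σ k ↔ ∀ c ∈ p.support, c.degree < k := Iff.rfl

theorem monomial_mem_degreeLT (c : σ →₀ ℕ) (a : ℝ) : monomial c a ∈ degreeLT σ (c.degree + 1) := by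
  simp [degreeLT]

theorem mem_degreeLT_of_totalDegree_lt {k : ℕ} {p : MvPolynomial σ ℝ} (h : p.totalDegree < k) :
    p ∈ degreeLT σ k := fun _ hc => (le_totalDegree hc).trans_lt h

theorem eq_zero_of_mem_degreeLT_zero {p : MvPolynomial σ ℝ} (h : p ∈ degreeLT σ 0) : p = 0 := by
  rw [← support_eq_empty]
  exact Finset.eq_empty_of_forall_notMem fun c hc => absurd (mem_degreeLT.1 h c hc) (by simp)

theorem degreeLT_mono {k l : ℕ} (h : k ≤ l) : degreeLT σ k ≤ degreeLT σ l :=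
  fun _ hp _ hc => lt_of_lt_of_le (hp hc) h

theorem mul_mem_degreeLT {k l : ℕ} {p q : MvPolynomial σ ℝ} (hp : p ∈ degreeLT σ k)
    (hq : q ∈ degreeLT σ (l + 1)) : p * q ∈ degreeLT σ (k + l) := by
  classical
  refine mem_degreeLT.2 fun c hc => ?_
  obtain ⟨a, ha, b, hb, rfl⟩ := Finset.mem_add.1 (support_mul p q hc)
  have h1 := mem_degreeLT.1 hp a ha
  have h2 := mem_degreeLT.1 hq b hb
  rw [map_add]
  omega

/-- `p` has leading form the monomial with exponent `c`. -/
def HasLeadingMonomial (p : MvPolynomial σ ℝ) (c : σ →₀ ℕ) : Prop :=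
  p - monomial c 1 ∈ degreeLT σ c.degree

theorem hasLeadingMonomial_monomial (c : σ →₀ ℕ) :
    HasLeadingMonomial (monomial c 1) c := by
  simp [HasLeadingMonomial]

theorem HasLeadingMonomial.mem_degreeLT {p : MvPolynomial σ ℝ} {c : σ →₀ ℕ}
    (h : HasLeadingMonomial p c) : p ∈ degreeLT σ (c.degree + 1) := by
  rw [← sub_add_cancel p (monomial c 1)]
  exact add_mem (degreeLT_mono (Nat.le_succ _) h) (monomial_mem_degreeLT c 1)

theorem HasLeadingMonomial.mul {p q : MvPolynomial σ ℝ} {c d : σ →₀ ℕ}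
    (hp : HasLeadingMonomial p c) (hq : HasLeadingMonomial q d) :
    HasLeadingMonomial (p * q) (c + d) := by
  have h : p * q - monomial (c + d) 1 =
      (p - monomial c 1) * q + (q - monomial d 1) * monomial c 1 := by
    have : (monomial (c + d) (1 : ℝ)) = monomial c 1 * monomial d 1 := by simp
    rw [this]; ring
  rw [HasLeadingMonomial, h, map_add]
  refine add_mem (mul_mem_degreeLT hp hq.mem_degreeLT) ?_
  rw [add_comm c.degree]
  exact mul_mem_degreeLT hq (monomial_mem_degreeLT c 1)

theorem HasLeadingMonomial.pow {p : MvPolynomial σ ℝ} {c : σ →₀ ℕ}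
    (hp : HasLeadingMonomial p c) (k : ℕ) : HasLeadingMonomial (p ^ k) (k • c) := by
  induction k with
  | zero => simpa using hasLeadingMonomial_monomial (0 : σ →₀ ℕ)
  | succ k ih => rw [pow_succ, succ_nsmul]; exact ih.mul hp

theorem HasLeadingMonomial.prod {ι : Type*} (s : Finset ι) {p : ι → MvPolynomial σ ℝ}
    {c : ι → σ →₀ ℕ} (h : ∀ i ∈ s, HasLeadingMonomial (p i) (c i)) :
    HasLeadingMonomial (∏ i ∈ s, p i) (∑ i ∈ s, c i) := by
  classical
  induction s using Finset.induction_on with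
  | empty => simpa using hasLeadingMonomial_monomial (0 : σ →₀ ℕ)
  | insert i s hi ih =>
    rw [Finset.prod_insert hi, Finset.sum_insert hi]
    exact (h i (by simp)).mul (ih fun j hj => h j (by simp [hj]))

variable [Fintype σ]

/-- The product `X ^ a * g ^ b`, where `c = a + e * b` is the division of `c` by `e`. -/
noncomputable def mixedMonomial (g : σ → MvPolynomial σ ℝ) (e : σ → ℕ) (c : σ →₀ ℕ) :
    MvPolynomial σ ℝ :=
  ∏ i, X i ^ (c i % e i) * g i ^ (c i / e i)

/-- The linear map sending each monomial to the corresponding mixed monomial. -/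
noncomputable def mixedMap (g : σ → MvPolynomial σ ℝ) (e : σ → ℕ) :
    MvPolynomial σ ℝ →ₗ[ℝ] MvPolynomial σ ℝ :=
  (basisMonomials σ ℝ).constr ℝ (mixedMonomial g e)

variable {g : σ → MvPolynomial σ ℝ} {e : σ → ℕ}

theorem mixedMap_monomial_one (c : σ →₀ ℕ) :
    mixedMap g e (monomial c 1) = mixedMonomial g e c := by
  rw [mixedMap, ← (basisMonomials σ ℝ).constr_basis ℝ (mixedMonomial g e) c, coe_basisMonomials]

theorem mixedMap_apply (p : MvPolynomial σ ℝ) :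
    mixedMap g e p = ∑ c ∈ p.support, coeff c p • mixedMonomial g e c := by
  conv_lhs => rw [p.as_sum]
  rw [map_sum]
  refine Finset.sum_congr rfl fun c _ => ?_
  rw [← mixedMap_monomial_one, ← map_smul, smul_monomial, smul_eq_mul, mul_one]

theorem hasLeadingMonomial_mixedMonomial
    (hg : ∀ i, HasLeadingMonomial (g i) (Finsupp.single i (e i))) (c : σ →₀ ℕ) :
    HasLeadingMonomial (mixedMonomial g e c) c := by
  have hc : c = ∑ i, ((c i % e i) • Finsupp.single i 1 + (c i / e i) • Finsupp.single i (e i)) := by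
    conv_lhs => rw [← Finsupp.univ_sum_single c]
    refine Finset.sum_congr rfl fun i _ => ?_
    rw [Finsupp.smul_single, Finsupp.smul_single, ← Finsupp.single_add, smul_eq_mul, smul_eq_mul,
      mul_one, Nat.mod_add_div']
  conv => arg 2; rw [hc]
  refine HasLeadingMonomial.prod _ fun i _ => ?_
  exact ((hasLeadingMonomial_monomial (Finsupp.single i 1)).pow _).mul ((hg i).pow _)

theorem mixedMap_sub_self_mem
    (hg : ∀ i, HasLeadingMonomial (g i) (Finsupp.single i (e i))) {k : ℕ} {p : MvPolynomial σ ℝ}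
    (hp : p ∈ degreeLT σ (k + 1)) : mixedMap g e p - p ∈ degreeLT σ k := by
  have : mixedMap g e p - p =
      ∑ c ∈ p.support, coeff c p • (mixedMonomial g e c - monomial c 1) := by
    conv_lhs => rw [mixedMap_apply]; arg 2; rw [p.as_sum]
    rw [← Finset.sum_sub_distrib]
    refine Finset.sum_congr rfl fun c _ => ?_
    rw [smul_sub, smul_monomial, smul_eq_mul, mul_one]
  rw [this]
  refine sum_mem fun c hc => Submodule.smul_mem _ _ ?_
  exact degreeLT_mono (Nat.lt_succ_iff.1 (mem_degreeLT.1 hp c hc))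
    (hasLeadingMonomial_mixedMonomial hg c)

theorem mixedMap_bijective (hg : ∀ i, HasLeadingMonomial (g i) (Finsupp.single i (e i))) :
    Function.Bijective (mixedMap g e) := by
  constructor
  · rw [injective_iff_map_eq_zero]
    intro p hp
    have key : ∀ k, p ∈ degreeLT σ k → p = 0 := by
      intro k
      induction k with
      | zero => exact eq_zero_of_mem_degreeLT_zero
      | succ k ih =>
        intro hk
        have := mixedMap_sub_self_mem hg hk
        rw [hp, zero_sub, neg_mem_iff] at this
        exact ih this
    exact key _ (mem_degreeLT_of_totalDegree_lt (Nat.lt_succ_self _))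
  · intro p
    have key : ∀ k, ∀ p ∈ degreeLT σ k, p ∈ LinearMap.range (mixedMap g e) := by
      intro k
      induction k with
      | zero => intro p hp; rw [eq_zero_of_mem_degreeLT_zero hp]; exact zero_mem _
      | succ k ih =>
        intro p hp
        rw [← sub_sub_cancel (mixedMap g e p) p]
        exact sub_mem ⟨p, rfl⟩ (ih _ (mixedMap_sub_self_mem hg hp))
    exact key _ p (mem_degreeLT_of_totalDegree_lt (Nat.lt_succ_self _))

theorem mixedMap_X_pow_mul (he : ∀ i, 0 < e i) (i : σ) (p : MvPolynomial σ ℝ) :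
    mixedMap g e (X i ^ e i * p) = g i * mixedMap g e p := by
  classical
  have h : mixedMap g e ∘ₗ LinearMap.mulLeft ℝ (X i ^ e i) =
      LinearMap.mulLeft ℝ (g i) ∘ₗ mixedMap g e := by
    refine (basisMonomials σ ℝ).ext fun c => ?_
    simp only [coe_basisMonomials, LinearMap.comp_apply, LinearMap.mulLeft_apply]
    rw [X_pow_eq_monomial, monomial_mul, one_mul, mixedMap_monomial_one, mixedMap_monomial_one,
      mixedMonomial, mixedMonomial, ← Finset.mul_prod_erase _ _ (Finset.mem_univ i),
      ← Finset.mul_prod_erase _ _ (Finset.mem_univ i), ← mul_assoc]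
    congr 1
    · simp [Nat.add_div_left _ (he i), pow_succ]
      ring
    · refine Finset.prod_congr rfl fun j hj => ?_
      simp [Finsupp.single_eq_of_ne (Finset.ne_of_mem_erase hj)]
  exact LinearMap.congr_fun h p

/-- The ideal generated by the `g i` consists of the images of the polynomials all of whose
monomials are divisible by some `X i ^ e i`. -/
theorem mixedMap_mem_span_iff (he : ∀ i, 0 < e i)
    (hg : ∀ i, HasLeadingMonomial (g i) (Finsupp.single i (e i))) (p : MvPolynomial σ ℝ) :
    mixedMap g e p ∈ Ideal.span (Set.range g) ↔ ∀ c ∈ p.support, ∃ i, e i ≤ c i := by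
  classical
  constructor
  · intro h
    obtain ⟨a, ha⟩ := Ideal.mem_span_range_iff_exists_fun.1 h
    choose b hb using fun i => (mixedMap_bijective hg).2 (a i)
    have hp : p = ∑ i, X i ^ e i * b i := by
      apply (mixedMap_bijective hg).1
      rw [map_sum, ← ha]
      exact Finset.sum_congr rfl fun i _ => by rw [mixedMap_X_pow_mul he, hb, mul_comm]
    intro c hc
    rw [hp] at hc
    obtain ⟨i, -, hi⟩ := Finset.mem_biUnion.1 (support_sum hc)
    rw [X_pow_eq_monomial] at hi
    obtain ⟨u, hu, v, -, rfl⟩ := Finset.mem_add.1 (support_mul _ _ hi)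
    rw [support_monomial, if_neg one_ne_zero, Finset.mem_singleton] at hu
    exact ⟨i, by simp [hu]⟩
  · intro h
    rw [mixedMap_apply]
    refine sum_mem fun c hc => Submodule.smul_of_tower_mem _ _ ?_
    obtain ⟨i, hi⟩ := h c hc
    rw [mixedMonomial, ← Finset.mul_prod_erase _ _ (Finset.mem_univ i)]
    refine Ideal.mul_mem_right _ _ (Ideal.mul_mem_left _ _ (Ideal.pow_mem_of_mem _
      (Ideal.subset_span (Set.mem_range_self i)) _ (Nat.div_pos hi (he i))))

end NormalForm

section Parity

variable {σ : Type*}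

/-- The substitution `x ↦ -x`. -/
noncomputable def negArg (σ : Type*) : MvPolynomial σ ℝ →ₐ[ℝ] MvPolynomial σ ℝ :=
  aeval fun i => -X i

theorem negArg_X (i : σ) : negArg σ (X i) = -X i := by simp [negArg]

theorem negArg_monomial (c : σ →₀ ℕ) (a : ℝ) :
    negArg σ (monomial c a) = (-1 : ℝ) ^ c.degree • monomial c a := by
  rw [negArg, aeval_monomial, monomial_eq, Finsupp.prod, Finsupp.prod, Finsupp.degree_apply,
    Finset.prod_congr rfl fun i _ => neg_pow (X i : MvPolynomial σ ℝ) (c i), Finset.prod_mul_distrib,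
    Finset.prod_pow_eq_pow_sum, smul_eq_C_mul]
  simp only [algebraMap_eq, map_pow, map_neg, map_one]
  ring

theorem coeff_negArg (c : σ →₀ ℕ) (p : MvPolynomial σ ℝ) :
    coeff c (negArg σ p) = (-1) ^ c.degree * coeff c p := by
  classical
  induction p using MvPolynomial.induction_on' with
  | monomial u a =>
    rw [negArg_monomial, coeff_smul, coeff_monomial, smul_eq_mul]
    split_ifs with h <;> simp [h]
  | add p q hp hq => rw [map_add, coeff_add, coeff_add, hp, hq, mul_add]

/-- The subalgebra of even polynomials. -/
noncomputable def evenSubalgebra (σ : Type*) : Subalgebra ℝ (MvPolynomial σ ℝ) :=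
  AlgHom.equalizer (negArg σ) (AlgHom.id ℝ _)

theorem mem_evenSubalgebra {p : MvPolynomial σ ℝ} :
    p ∈ evenSubalgebra σ ↔ negArg σ p = p := Iff.rfl

theorem mem_evenSubalgebra_iff_support {p : MvPolynomial σ ℝ} :
    p ∈ evenSubalgebra σ ↔ ∀ c ∈ p.support, Even c.degree := by
  rw [mem_evenSubalgebra, MvPolynomial.ext_iff]
  refine forall_congr' fun c => ?_
  rw [coeff_negArg, mem_support_iff]
  rcases Nat.even_or_odd c.degree with h | h
  · simp [h]
  · simp only [h.neg_one_pow, neg_one_mul, Nat.not_even_iff_odd.2 h, imp_false, not_not]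
    constructor <;> intro h' <;> linarith

variable [Fintype σ] {g : σ → MvPolynomial σ ℝ} {e : σ → ℕ}

theorem negArg_mixedMap (hpar : ∀ i, negArg σ (g i) = (-1) ^ e i * g i) (p : MvPolynomial σ ℝ) :
    negArg σ (mixedMap g e p) = mixedMap g e (negArg σ p) := by
  have h : (negArg σ).toLinearMap ∘ₗ mixedMap g e = mixedMap g e ∘ₗ (negArg σ).toLinearMap := by
    refine (basisMonomials σ ℝ).ext fun c => ?_
    simp only [coe_basisMonomials, LinearMap.comp_apply, AlgHom.toLinearMap_apply]
    rw [negArg_monomial, map_smul, mixedMap_monomial_one, mixedMonomial, map_prod,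
      Finsupp.degree_eq_sum, ← Finset.prod_pow_eq_pow_sum, smul_eq_C_mul, map_prod,
      ← Finset.prod_mul_distrib]
    refine Finset.prod_congr rfl fun i _ => ?_
    rw [map_mul, map_pow, map_pow, hpar, negArg_X, neg_pow, mul_pow, ← pow_mul]
    have h : (-1 : MvPolynomial σ ℝ) ^ c i = (-1) ^ (c i % e i) * (-1) ^ (e i * (c i / e i)) := by
      rw [← pow_add, Nat.mod_add_div]
    simp only [map_pow, map_neg, map_one, h]
    ring
  exact LinearMap.congr_fun h p

theorem mixedMap_mem_evenSubalgebra_iff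
    (hg : ∀ i, HasLeadingMonomial (g i) (Finsupp.single i (e i)))
    (hpar : ∀ i, negArg σ (g i) = (-1) ^ e i * g i) (p : MvPolynomial σ ℝ) :
    mixedMap g e p ∈ evenSubalgebra σ ↔ p ∈ evenSubalgebra σ := by
  rw [mem_evenSubalgebra, mem_evenSubalgebra, negArg_mixedMap hpar,
    (mixedMap_bijective hg).1.eq_iff]

end Parity

end MvPolynomial

theorem Finset.odd_card_filter_even_sum {σ : Type*} [Fintype σ] [DecidableEq σ] {e : σ → ℕ}
    {i₀ : σ} {u : ℕ} (hu : Odd u) (h₀ : e i₀ = 2 * u) (hodd : ∀ i ≠ i₀, Odd (e i)) :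
    Odd ((Fintype.piFinset fun i => Finset.range (e i)).filter fun a => Even (∑ i, a i)).card := by
  set B := Fintype.piFinset fun i => Finset.range (e i)
  have hsum : ∑ a ∈ B, (-1 : ℤ) ^ (∑ i, a i) = 0 := by
    simp_rw [← Finset.prod_pow_eq_pow_sum]
    rw [← Finset.prod_univ_sum (fun i => Finset.range (e i)) fun _ j => (-1 : ℤ) ^ j]
    refine Finset.prod_eq_zero (Finset.mem_univ i₀) ?_
    rw [h₀]
    simp
  have hcard : B.card = 2 * u * ∏ i ∈ Finset.univ.erase i₀, e i := by
    rw [Fintype.card_piFinset, ← Finset.mul_prod_erase _ _ (Finset.mem_univ i₀)]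
    simp [h₀]
  have hprod : Odd (∏ i ∈ Finset.univ.erase i₀, e i) :=
    Finset.prod_induction _ Odd (fun _ _ => Odd.mul) odd_one
      fun i hi => hodd i (Finset.ne_of_mem_erase hi)
  have hsplit := Finset.card_filter_add_card_filter_not (s := B) (fun a => Even (∑ i, a i))
  rw [← Finset.sum_filter_add_sum_filter_not B (fun a => Even (∑ i, a i)),
    Finset.sum_congr rfl fun a ha => (Finset.mem_filter.1 ha).2.neg_one_pow,
    Finset.sum_congr rfl fun a ha =>
      (Nat.not_even_iff_odd.1 (Finset.mem_filter.1 ha).2).neg_one_pow] at hsum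
  simp only [Finset.sum_const, nsmul_eq_mul] at hsum
  have : (B.filter fun a => Even (∑ i, a i)).card = u * ∏ i ∈ Finset.univ.erase i₀, e i := by
    rw [mul_assoc] at hcard
    omega
  rw [this]
  exact hu.mul hprod

namespace MvPolynomial

theorem odd_finrank_quotient_comap_evenSubalgebra {σ : Type*} [Fintype σ]
    {g : σ → MvPolynomial σ ℝ} {e : σ → ℕ} {i₀ : σ} {u : ℕ} (hu : Odd u) (h₀ : e i₀ = 2 * u)
    (hodd : ∀ i ≠ i₀, Odd (e i))
    (hg : ∀ i, HasLeadingMonomial (g i) (Finsupp.single i (e i)))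
    (hpar : ∀ i, negArg σ (g i) = (-1) ^ e i * g i) :
    Odd (Module.finrank ℝ
      (evenSubalgebra σ ⧸ (Ideal.span (Set.range g)).comap (evenSubalgebra σ).val)) := by
  classical
  have he : ∀ i, 0 < e i := fun i => by
    by_cases hi : i = i₀
    · rw [hi, h₀]; exact Nat.mul_pos two_pos hu.pos
    · exact (hodd i hi).pos
  let T := LinearEquiv.ofBijective (mixedMap g e) (mixedMap_bijective hg)
  have hT : ∀ p, mixedMap g e (T.symm p) = p := T.apply_symm_apply
  let S := (Fintype.piFinset fun i => Finset.range (e i)).filter fun a => Even (∑ i, a i)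
  let ι : (σ → ℕ) → σ →₀ ℕ := Finsupp.equivFunOnFinite.symm
  have hι : ∀ a b, ι a = ι b ↔ a = b := fun a b => Finsupp.equivFunOnFinite.symm.injective.eq_iff
  let Ψ : evenSubalgebra σ →ₗ[ℝ] (S → ℝ) :=
    LinearMap.pi fun s => lcoeff ℝ (ι s) ∘ₗ T.symm.toLinearMap ∘ₗ
      (evenSubalgebra σ).val.toLinearMap
  have hΨ : ∀ p s, Ψ p s = coeff (ι s) (T.symm (p : MvPolynomial σ ℝ)) := fun _ _ => rfl
  have hsurj : Function.Surjective Ψ := by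
    intro f
    let q : MvPolynomial σ ℝ := ∑ s : S, monomial (ι s) (f s)
    have hq : q ∈ evenSubalgebra σ := by
      refine sum_mem fun s _ => ?_
      have hs : Even (ι s).degree := by
        rw [Finsupp.degree_eq_sum]; exact (Finset.mem_filter.1 s.2).2
      rw [mem_evenSubalgebra, negArg_monomial, hs.neg_one_pow, one_smul]
    refine ⟨⟨mixedMap g e q, (mixedMap_mem_evenSubalgebra_iff hg hpar q).2 hq⟩, ?_⟩
    ext s
    have : T.symm (mixedMap g e q) = q := T.symm_apply_apply q
    simp only [hΨ, this, q, coeff_sum, coeff_monomial, hι]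
    simp
  let J : Ideal (evenSubalgebra σ) := (Ideal.span (Set.range g)).comap (evenSubalgebra σ).val
  have hker : LinearMap.ker Ψ = J.restrictScalars ℝ := by
    ext p
    have hp : T.symm (p : MvPolynomial σ ℝ) ∈ evenSubalgebra σ := by
      rw [← mixedMap_mem_evenSubalgebra_iff hg hpar, hT]; exact p.2
    rw [mem_evenSubalgebra_iff_support] at hp
    have hJ : p ∈ J.restrictScalars ℝ ↔ (p : MvPolynomial σ ℝ) ∈ Ideal.span (Set.range g) :=
      Iff.rfl
    rw [hJ, ← hT p, mixedMap_mem_span_iff he hg, LinearMap.mem_ker]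
    constructor
    · intro h c hc
      by_contra! hlt
      refine mem_support_iff.1 hc ?_
      have h' := congrFun h ⟨c, ?_⟩
      rotate_left
      · refine Finset.mem_filter.2 ⟨by simpa using hlt, ?_⟩
        rw [← Finsupp.degree_eq_sum]; exact hp c hc
      · have hιc : ι c = c := Finsupp.equivFunOnFinite.symm_apply_apply c
        simpa [hΨ, hιc] using h'
    · intro h
      ext s
      by_contra hs
      obtain ⟨i, hi⟩ := h _ (mem_support_iff.2 hs)
      have := Finset.mem_range.1 (Fintype.mem_piFinset.1 (Finset.mem_filter.1 s.2).1 i)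
      exact absurd hi (not_le.2 this)
  rw [((Submodule.Quotient.restrictScalarsEquiv ℝ J).symm.trans
    ((Submodule.quotEquivOfEq _ _ hker.symm).trans
      (Ψ.quotKerEquivOfSurjective hsurj))).finrank_eq,
    Module.finrank_fintype_fun_eq_card, Fintype.card_coe]
  exact Finset.odd_card_filter_even_sum hu h₀ hodd

theorem exists_evenSubalgebra_algHom {σ : Type*} [Fintype σ] {g : σ → MvPolynomial σ ℝ}
    {e : σ → ℕ} {i₀ : σ} {u : ℕ} (hu : Odd u) (h₀ : e i₀ = 2 * u) (hodd : ∀ i ≠ i₀, Odd (e i))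
    (hg : ∀ i, HasLeadingMonomial (g i) (Finsupp.single i (e i)))
    (hpar : ∀ i, negArg σ (g i) = (-1) ^ e i * g i) :
    ∃ φ : evenSubalgebra σ →ₐ[ℝ] ℝ,
      ∀ p : evenSubalgebra σ, (p : MvPolynomial σ ℝ) ∈ Ideal.span (Set.range g) → φ p = 0 := by
  obtain ⟨φ, hφ⟩ := exists_algHom_real_of_odd_finrank_quotient _
    (odd_finrank_quotient_comap_evenSubalgebra hu h₀ hodd hg hpar)
  exact ⟨φ, fun p hp => hφ p (Ideal.mem_comap.2 hp)⟩

end MvPolynomial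

namespace MvPolynomial

theorem X_mul_X_mem_evenSubalgebra {σ : Type*} (i j : σ) :
    (X i * X j : MvPolynomial σ ℝ) ∈ evenSubalgebra σ := by
  rw [mem_evenSubalgebra, map_mul, negArg_X, negArg_X, neg_mul_neg]

theorem exists_eval_eq_of_evenSubalgebra_algHom {σ : Type*} [Fintype σ]
    (φ : evenSubalgebra σ →ₐ[ℝ] ℝ) {j : σ}
    (hj : 0 < φ ⟨X j * X j, X_mul_X_mem_evenSubalgebra j j⟩) :
    ∃ x : σ → ℝ, x j ≠ 0 ∧ ∀ p : evenSubalgebra σ, φ p = eval x (p : MvPolynomial σ ℝ) := by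
  set w : σ → evenSubalgebra σ := fun i => ⟨X i * X j, X_mul_X_mem_evenSubalgebra i j⟩
  set s := √(φ (w j))
  have hs : 0 < s := Real.sqrt_pos.2 hj
  have hss : φ (w j) = s * s := (Real.mul_self_sqrt hj.le).symm
  let x : σ → ℝ := fun i => φ (w i) / s
  have hx : ∀ i, φ (w i) = x i * s := fun i => (div_mul_cancel₀ _ hs.ne').symm
  have hmon : ∀ (c : σ →₀ ℕ) (h : monomial c (1 : ℝ) ∈ evenSubalgebra σ),
      φ ⟨monomial c 1, h⟩ = eval x (monomial c 1) := by
    intro c h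
    obtain ⟨k, hk⟩ := mem_evenSubalgebra_iff_support.1 h c
      (by classical simp [coeff_monomial])
    rw [Finsupp.degree_eq_sum] at hk
    have hmul : (⟨monomial c 1, h⟩ : evenSubalgebra σ) * w j ^ k = ∏ i, w i ^ c i := by
      apply Subtype.ext
      simp only [w, MulMemClass.coe_mul, SubmonoidClass.coe_pow, SubmonoidClass.coe_finsetProd,
        mul_pow, Finset.prod_mul_distrib, Finset.prod_pow_eq_pow_sum, hk, pow_add]
      rw [monomial_eq, Finsupp.prod_fintype _ _ (fun _ => pow_zero _), C_1, one_mul]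
    have := congrArg φ hmul
    simp only [map_mul, map_pow, map_prod, hss, hx, mul_pow, Finset.prod_mul_distrib,
      Finset.prod_pow_eq_pow_sum, hk, pow_add] at this
    rw [mul_right_cancel₀ (by positivity) this, eval_monomial, one_mul,
      Finsupp.prod_fintype _ _ (fun _ => pow_zero _)]
  refine ⟨x, ?_, fun p => ?_⟩
  · exact (div_pos hj hs).ne'
  · have hp : ∀ c ∈ (p : MvPolynomial σ ℝ).support, monomial c (1 : ℝ) ∈ evenSubalgebra σ :=
      fun c hc => by
        rw [mem_evenSubalgebra, negArg_monomial,
          (mem_evenSubalgebra_iff_support.1 p.2 c hc).neg_one_pow, one_smul]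
    have hsum : p = ∑ c ∈ (p : MvPolynomial σ ℝ).support.attach,
        coeff c.1 (p : MvPolynomial σ ℝ) •
          (⟨monomial c.1 1, hp c.1 c.2⟩ : evenSubalgebra σ) := by
      apply Subtype.ext
      conv_lhs => rw [(p : MvPolynomial σ ℝ).as_sum, ← Finset.sum_attach]
      simp [smul_monomial]
    conv_rhs => rw [(p : MvPolynomial σ ℝ).as_sum, ← Finset.sum_attach]
    conv_lhs => rw [hsum]
    simp only [map_sum, map_smul, hmon]
    simp [eval_monomial]

/-- An approximate Borsuk–Ulam theorem for odd polynomial maps. -/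
theorem exists_abs_eval_le_of_odd {ι : Type*} [Fintype ι] (f : ι → MvPolynomial (Option ι) ℝ)
    (hf : ∀ i, negArg _ (f i) = -f i) {ε : ℝ} (hε : 0 < ε) :
    ∃ x : Option ι → ℝ, x none ^ 6 + ∑ i, x (some i) ^ 2 = 1 ∧ ∀ i, |eval x (f i)| ≤ ε := by
  classical
  set D := 2 * ∑ i, (f i).totalDegree + 1
  have hDodd : Odd D := odd_two_mul_add_one _
  have hfD : ∀ i, (f i).totalDegree < D := fun i => by
    have := Finset.single_le_sum (f := fun i => (f i).totalDegree) (fun _ _ => Nat.zero_le _)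
      (Finset.mem_univ i)
    omega
  let e : Option ι → ℕ := fun i => i.elim 6 fun _ => D
  let r : Option ι → MvPolynomial (Option ι) ℝ :=
    fun i => i.elim (∑ k, X (some k) ^ 2 - 1) fun i => C ε⁻¹ * f i
  let g : Option ι → MvPolynomial (Option ι) ℝ := fun i => X i ^ e i + r i
  have hr : ∀ i, (r i).totalDegree < e i := by
    rintro (_ | i)
    · refine (totalDegree_sub _ _).trans_lt (max_lt ?_ (by simp [e]))
      refine (totalDegree_finsetSum_le (d := 2) fun i _ => ?_).trans_lt (by simp [e])
      simp
    · refine (totalDegree_mul _ _).trans_lt ?_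
      simpa [e] using hfD i
  have hg : ∀ i, HasLeadingMonomial (g i) (Finsupp.single i (e i)) := fun i => by
    rw [HasLeadingMonomial, ← X_pow_eq_monomial, add_sub_cancel_left, Finsupp.degree_single]
    exact mem_degreeLT_of_totalDegree_lt (hr i)
  have hpar : ∀ i, negArg _ (g i) = (-1) ^ e i * g i := by
    rintro (_ | i)
    · have h6 : Even 6 := by decide
      simp [g, r, e, negArg_X, h6.neg_pow]
    · have hC : negArg (Option ι) (C ε⁻¹) = C ε⁻¹ := (negArg (Option ι)).commutes _
      simp only [g, r, e, Option.elim_some, map_add, map_mul, map_pow, negArg_X, hf, hC,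
        hDodd.neg_pow]
      ring
  obtain ⟨φ, hφ⟩ := exists_evenSubalgebra_algHom (u := 3) (by decide) (e := e) (i₀ := none) rfl
    (by rintro (_ | i) hi; exacts [absurd rfl hi, hDodd]) hg hpar
  have hgI : ∀ i, g i ∈ Ideal.span (Set.range g) := fun i => Ideal.subset_span ⟨i, rfl⟩
  let w : Option ι → evenSubalgebra (Option ι) :=
    fun i => ⟨X i * X i, X_mul_X_mem_evenSubalgebra i i⟩
  have hg0 : g none = ((w none ^ 3 + (∑ i, w (some i) - 1) : evenSubalgebra (Option ι)) :
      MvPolynomial (Option ι) ℝ) := by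
    simp [g, r, e, w, ← pow_two, ← pow_mul]
  have hw : φ (w none) ^ 3 + (∑ i, φ (w (some i)) - 1) = 0 := by
    have := hφ (w none ^ 3 + (∑ i, w (some i) - 1)) (hg0 ▸ hgI none)
    rwa [map_add, map_pow, map_sub, map_sum, map_one] at this
  obtain ⟨j, hj⟩ : ∃ j, 0 < φ (w j) := by
    by_contra! hneg
    have h1 : φ (w none) ^ 3 ≤ 0 := Odd.pow_nonpos (by decide) (hneg none)
    have h2 : ∑ i, φ (w (some i)) ≤ 0 := Finset.sum_nonpos fun i _ => hneg _
    linarith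
  obtain ⟨x, hxj, hx⟩ := exists_eval_eq_of_evenSubalgebra_algHom φ hj
  have hx0 : x none ^ 6 + ∑ i, x (some i) ^ 2 = 1 := by
    simp only [hx, w, map_mul, eval_X] at hw
    simp only [← pow_two, ← pow_mul] at hw
    norm_num at hw
    linarith
  refine ⟨x, hx0, fun i => ?_⟩
  have hev : X j * g (some i) ∈ evenSubalgebra (Option ι) := by
    rw [mem_evenSubalgebra, map_mul, negArg_X, hpar]
    simp [e, hDodd.neg_one_pow]
  have hzero : x j * (x (some i) ^ D + ε⁻¹ * eval x (f i)) = 0 := by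
    have := hφ ⟨_, hev⟩ (Ideal.mul_mem_left _ _ (hgI _))
    rw [hx] at this
    simpa [g, r, e] using this
  have hfi : eval x (f i) = -ε * x (some i) ^ D := by
    have := (mul_eq_zero.1 hzero).resolve_left hxj
    field_simp at this
    linarith
  have hxi : |x (some i)| ≤ 1 := by
    rw [← sq_le_one_iff_abs_le_one]
    have := Finset.single_le_sum (f := fun i => x (some i) ^ 2) (fun _ _ => sq_nonneg _)
      (Finset.mem_univ i)
    have h6 : 0 ≤ x none ^ 6 := Even.pow_nonneg (by decide) _
    linarith
  rw [hfi, abs_mul, abs_neg, abs_of_pos hε, abs_pow]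
  exact mul_le_of_le_one_right hε.le (pow_le_one₀ (abs_nonneg _) hxi)

end MvPolynomial

theorem Polynomial.exists_odd_approx_sign (R : ℝ) {η : ℝ} (hη : 0 < η) :
    ∃ q : Polynomial ℝ, q.comp (-Polynomial.X) = -q ∧ ∀ t ∈ Set.Icc (-R) R,
      |q.eval t| ≤ 1 + η ∧ (η ≤ t → 1 - η ≤ q.eval t) := by
  let f : ℝ → ℝ := fun t => max (-1) (min 1 (t / η))
  have hf : Continuous f := by fun_prop
  obtain ⟨p, hp⟩ := exists_polynomial_near_of_continuousOn (-R) R f hf.continuousOn η hη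
  have hodd : ∀ t, f (-t) = -f t := fun t => by
    simp only [f, neg_div]
    grind
  refine ⟨Polynomial.C (1 / 2) * (p - p.comp (-Polynomial.X)), ?_, fun t ht => ?_⟩
  · simp only [Polynomial.mul_comp, Polynomial.sub_comp, Polynomial.C_comp, Polynomial.comp_assoc,
      Polynomial.neg_comp, Polynomial.X_comp, neg_neg, Polynomial.comp_X]
    ring
  · have h1 := abs_lt.1 (hp t ht)
    have h2 := abs_lt.1 (hp (-t) ⟨neg_le_neg ht.2, neg_le.1 ht.1⟩)
    rw [hodd] at h2
    have hle : f t ≤ 1 := max_le (by norm_num) (min_le_left _ _)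
    have hge : -1 ≤ f t := le_max_left _ _
    simp only [Polynomial.eval_mul, Polynomial.eval_C, Polynomial.eval_sub, Polynomial.eval_comp,
      Polynomial.eval_neg, Polynomial.eval_X]
    refine ⟨abs_le.2 ⟨by linarith, by linarith⟩, fun h => ?_⟩
    have : f t = 1 := by
      simp only [f]
      rw [min_eq_left ((one_le_div hη).2 h)]
      norm_num
    linarith

theorem two_mul_card_filter_le_of_sum_le {α : Type*} (s : Finset α) (L q : α → ℝ) {η : ℝ}
    (hηs : η * (s.card + 1) < 1) (hq : ∀ a ∈ s, -(1 + η) ≤ q a)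
    (hqL : ∀ a ∈ s, η ≤ L a → 1 - η ≤ q a) (hsum : ∑ a ∈ s, q a ≤ η) :
    2 * {a ∈ s | η ≤ L a}.card ≤ s.card := by
  have hsplit := Finset.card_filter_add_card_filter_not (s := s) (fun a => η ≤ L a)
  rw [← Finset.sum_filter_add_sum_filter_not s (fun a => η ≤ L a)] at hsum
  have h1 := Finset.card_nsmul_le_sum {a ∈ s | η ≤ L a} q (1 - η) fun a ha =>
    hqL a (Finset.mem_filter.1 ha).1 (Finset.mem_filter.1 ha).2
  have h2 := Finset.card_nsmul_le_sum {a ∈ s | ¬ η ≤ L a} q (-(1 + η)) fun a ha =>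
    hq a (Finset.mem_filter.1 ha).1
  rw [nsmul_eq_mul] at h1 h2
  have hsplit' : (({a ∈ s | η ≤ L a}.card : ℕ) : ℝ) + ({a ∈ s | ¬ η ≤ L a}.card : ℕ) = s.card := by
    exact_mod_cast hsplit
  have : (2 * {a ∈ s | η ≤ L a}.card : ℝ) < s.card + 1 := by nlinarith
  exact Nat.lt_succ_iff.1 (by exact_mod_cast this)

section HamSandwich

variable {ι α : Type*} [Fintype ι]

theorem isCompact_setOf_pow_six_add_sum_sq_eq_one :
    IsCompact {x : Option ι → ℝ | x none ^ 6 + ∑ i, x (some i) ^ 2 = 1} ∧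
    ∀ x : Option ι → ℝ, x none ^ 6 + ∑ i, x (some i) ^ 2 = 1 → ∀ j, |x j| ≤ 1 := by
  have hbd : ∀ x : Option ι → ℝ, x none ^ 6 + ∑ i, x (some i) ^ 2 = 1 → ∀ j, |x j| ≤ 1 := by
    intro x hx j
    have h6 : 0 ≤ x none ^ 6 := Even.pow_nonneg (by decide) _
    have hs : ∀ i, x (some i) ^ 2 ≤ ∑ i, x (some i) ^ 2 := fun i =>
      Finset.single_le_sum (f := fun i => x (some i) ^ 2) (fun _ _ => sq_nonneg _)
        (Finset.mem_univ i)
    rcases j with _ | i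
    · have h0 : 0 ≤ ∑ i, x (some i) ^ 2 := Finset.sum_nonneg fun _ _ => sq_nonneg _
      rw [← pow_le_one_iff_of_nonneg (abs_nonneg _) (n := 6) (by norm_num), ← abs_pow,
        abs_of_nonneg h6]
      linarith
    · rw [← sq_le_one_iff_abs_le_one]
      linarith [hs i]
  refine ⟨?_, hbd⟩
  refine (isCompact_univ_pi fun _ : Option ι =>
    isCompact_Icc (a := (-1 : ℝ)) (b := 1)).of_isClosed_subset
    (isClosed_eq (by fun_prop) continuous_const) fun x hx j _ => abs_le.1 (hbd x hx j)

theorem exists_approx_bisecting (E : ι → Finset α) (l : α → Option ι → ℝ) {η : ℝ} (hη : 0 < η)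
    (hηE : ∀ i, η * ((E i).card + 1) < 1) :
    ∃ x : Option ι → ℝ, x none ^ 6 + ∑ i, x (some i) ^ 2 = 1 ∧ ∀ i,
      2 * {a ∈ E i | η ≤ ∑ j, l a j * x j}.card ≤ (E i).card ∧
      2 * {a ∈ E i | η ≤ -∑ j, l a j * x j}.card ≤ (E i).card := by
  obtain ⟨q, hqodd, hq⟩ :=
    Polynomial.exists_odd_approx_sign (∑ i, ∑ a ∈ E i, ∑ j, |l a j|) hη
  have hqneg : ∀ t, q.eval (-t) = -q.eval t := fun t => by
    simpa using congrArg (Polynomial.eval t) hqodd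
  let f : ι → MvPolynomial (Option ι) ℝ := fun i => ∑ a ∈ E i,
    Polynomial.aeval (∑ j, MvPolynomial.C (l a j) * MvPolynomial.X j) q
  have hf : ∀ i, MvPolynomial.negArg _ (f i) = -f i := by
    intro i
    have hC : ∀ c, MvPolynomial.negArg (Option ι) (MvPolynomial.C c) = MvPolynomial.C c :=
      (MvPolynomial.negArg (Option ι)).commutes
    simp only [f]
    rw [map_sum, ← Finset.sum_neg_distrib]
    refine Finset.sum_congr rfl fun a _ => ?_
    rw [← Polynomial.aeval_algHom_apply, ← map_neg (Polynomial.aeval _) q, ← hqodd,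
      Polynomial.aeval_comp]
    simp [hC, MvPolynomial.negArg_X, -Fintype.sum_option]
  obtain ⟨x, hx, hfx⟩ := MvPolynomial.exists_abs_eval_le_of_odd f hf hη
  refine ⟨x, hx, fun i => ?_⟩
  set L : α → ℝ := fun a => ∑ j, l a j * x j with hL
  have hfi : MvPolynomial.eval x (f i) = ∑ a ∈ E i, q.eval (L a) := by
    simp only [f, map_sum]
    refine Finset.sum_congr rfl fun a _ => ?_
    have := Polynomial.aeval_algHom_apply
      (MvPolynomial.aeval x : MvPolynomial (Option ι) ℝ →ₐ[ℝ] ℝ)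
      (∑ j, MvPolynomial.C (l a j) * MvPolynomial.X j) q
    simpa [MvPolynomial.aeval_eq_eval, hL] using this.symm
  have hsum := abs_le.1 (hfi ▸ hfx i)
  have hLR : ∀ a ∈ E i, |L a| ≤ ∑ i, ∑ a ∈ E i, ∑ j, |l a j| := by
    intro a ha
    calc |L a| ≤ ∑ j, |l a j * x j| := Finset.abs_sum_le_sum_abs _ _
      _ ≤ ∑ j, |l a j| := Finset.sum_le_sum fun j _ => by
        rw [abs_mul]
        exact mul_le_of_le_one_right (abs_nonneg _)
          (isCompact_setOf_pow_six_add_sum_sq_eq_one.2 x hx j)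
      _ ≤ ∑ a ∈ E i, ∑ j, |l a j| := Finset.single_le_sum (f := fun a => ∑ j, |l a j|)
        (fun _ _ => Finset.sum_nonneg fun _ _ => abs_nonneg _) ha
      _ ≤ _ := Finset.single_le_sum (f := fun i => ∑ a ∈ E i, ∑ j, |l a j|)
        (fun _ _ => Finset.sum_nonneg fun _ _ => Finset.sum_nonneg fun _ _ => abs_nonneg _)
        (Finset.mem_univ i)
  constructor
  · exact two_mul_card_filter_le_of_sum_le (E i) L (fun a => q.eval (L a)) (hηE i)
      (fun a ha => (abs_le.1 (hq _ (abs_le.1 (hLR a ha))).1).1)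
      (fun a ha => (hq _ (abs_le.1 (hLR a ha))).2) hsum.2
  · refine two_mul_card_filter_le_of_sum_le (E i) (fun a => -L a) (fun a => q.eval (-L a))
      (hηE i) (fun a ha => ?_) (fun a ha => ?_) ?_
    · exact (abs_le.1 (hq _ (abs_le.1 ((abs_neg (L a)).trans_le (hLR a ha)))).1).1
    · exact (hq _ (abs_le.1 ((abs_neg (L a)).trans_le (hLR a ha)))).2
    · simp only [hqneg, Finset.sum_neg_distrib]
      linarith [hsum.1]

/-- The discrete ham sandwich theorem for linear forms. -/
theorem exists_bisecting (E : ι → Finset α) (l : α → Option ι → ℝ) :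
    ∃ x : Option ι → ℝ, x ≠ 0 ∧ ∀ i,
      2 * {a ∈ E i | 0 < ∑ j, l a j * x j}.card ≤ (E i).card ∧
      2 * {a ∈ E i | ∑ j, l a j * x j < 0}.card ≤ (E i).card := by
  let M := ∑ i, (E i).card
  let η : ℕ → ℝ := fun k => 1 / ((k + (M + 1) : ℕ) + 1 : ℝ)
  have hη : ∀ k, 0 < η k := fun k => by positivity
  have hηE : ∀ k i, η k * ((E i).card + 1) < 1 := by
    intro k i
    have hM : (E i).card ≤ M := Finset.single_le_sum (f := fun i => (E i).card)
      (fun _ _ => Nat.zero_le _) (Finset.mem_univ i)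
    rw [one_div_mul_eq_div, div_lt_one (by positivity)]
    have : (E i).card + 1 < k + (M + 1) + 1 := by omega
    exact_mod_cast this
  have hηlim : Filter.Tendsto η Filter.atTop (nhds 0) :=
    (Filter.tendsto_add_atTop_iff_nat (M + 1)).2 tendsto_one_div_add_atTop_nhds_zero_nat
  choose y hy hyE using fun k => exists_approx_bisecting E l (hη k) (hηE k)
  obtain ⟨x, hx, u, hu, hlim⟩ := isCompact_setOf_pow_six_add_sum_sq_eq_one.1.tendsto_subseq hy
  have hηu := hηlim.comp hu.tendsto_atTop
  have hLlim : ∀ a, Filter.Tendsto (fun k => ∑ j, l a j * y (u k) j) Filter.atTop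
      (nhds (∑ j, l a j * x j)) := fun a =>
    tendsto_finsetSum _ fun j _ => (tendsto_pi_nhds.1 hlim j).const_mul _
  refine ⟨x, ?_, fun i => ⟨?_, ?_⟩⟩
  · rintro rfl
    simp at hx
  · have h : ∀ᶠ k in Filter.atTop, ∀ a ∈ {a ∈ E i | 0 < ∑ j, l a j * x j},
        η (u k) ≤ ∑ j, l a j * y (u k) j := by
      rw [Filter.eventually_all_finset]
      intro a ha
      exact (hηu.eventually_lt (hLlim a) (Finset.mem_filter.1 ha).2).mono fun _ h => h.le
    obtain ⟨k, hk⟩ := h.exists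
    refine le_trans (Nat.mul_le_mul_left 2 (Finset.card_le_card fun a ha => ?_)) (hyE (u k) i).1
    exact Finset.mem_filter.2 ⟨(Finset.mem_filter.1 ha).1, hk a ha⟩
  · have h : ∀ᶠ k in Filter.atTop, ∀ a ∈ {a ∈ E i | ∑ j, l a j * x j < 0},
        η (u k) ≤ -∑ j, l a j * y (u k) j := by
      rw [Filter.eventually_all_finset]
      intro a ha
      exact (hηu.eventually_lt (hLlim a).neg
        (neg_pos.2 (Finset.mem_filter.1 ha).2)).mono fun _ h => h.le
    obtain ⟨k, hk⟩ := h.exists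
    refine le_trans (Nat.mul_le_mul_left 2 (Finset.card_le_card fun a ha => ?_)) (hyE (u k) i).2
    exact Finset.mem_filter.2 ⟨(Finset.mem_filter.1 ha).1, hk a ha⟩

end HamSandwich

theorem exists_embedding_finsupp_degree_le (n d m : ℕ) (hm : m < (d + n).choose n) :
    ∃ u : Option (Fin m) ↪ (Fin n →₀ ℕ), ∀ j, (u j).degree ≤ d := by
  let S := (Finset.univ : Finset (Option (Fin n))).finsuppAntidiag d
  have hcard : Fintype.card (Option (Fin m)) ≤ Fintype.card S := by
    rw [Fintype.card_coe, Finset.card_finsuppAntidiag_nat_eq_choose, Finset.card_univ,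
      Fintype.card_option, Fintype.card_option, Fintype.card_fin, Fintype.card_fin,
      show n + 1 + d - 1 = d + n by omega, Nat.choose_symm_add]
    exact hm
  obtain ⟨v⟩ := Function.Embedding.nonempty_of_card_le hcard
  have hS : ∀ c : S,
      (c : Option (Fin n) →₀ ℕ) none + (c : Option (Fin n) →₀ ℕ).some.degree = d := by
    intro c
    have := (Finset.mem_finsuppAntidiag.1 c.2).1
    rw [Fintype.sum_option] at this
    rw [Finsupp.degree_eq_sum]
    simpa using this
  refine ⟨⟨fun j => (v j : Option (Fin n) →₀ ℕ).some, fun j k hjk => v.injective ?_⟩, fun j => ?_⟩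
  · have h1 := hS (v j)
    have h2 := hS (v k)
    have hsome : (v j : Option (Fin n) →₀ ℕ).some = (v k : Option (Fin n) →₀ ℕ).some := hjk
    rw [← hsome] at h2
    apply Subtype.ext
    ext i
    rcases i with _ | i
    · omega
    · exact DFunLike.congr_fun hsome i
  · have := hS (v j)
    change (v j : Option (Fin n) →₀ ℕ).some.degree ≤ d
    omega

/-- **Polynomial ham sandwich theorem, discrete case** (Theorem 6.5). -/
theorem polynomial_ham_sandwich_discrete (n : ℕ) (hn : 1 ≤ n) (d m : ℕ)
    (hm : m < (d + n).choose n) (E : Fin m → Finset (Fin n → ℝ)) :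
    ∃ P : MvPolynomial (Fin n) ℝ, P ≠ 0 ∧ P.totalDegree ≤ d ∧
      ∀ i, 2 * {x ∈ (E i : Set (Fin n → ℝ)) | 0 < MvPolynomial.eval x P}.ncard ≤ (E i).card ∧
           2 * {x ∈ (E i : Set (Fin n → ℝ)) | MvPolynomial.eval x P < 0}.ncard ≤ (E i).card := by
  classical
  obtain ⟨u, hu⟩ := exists_embedding_finsupp_degree_le n d m hm
  obtain ⟨x, hx0, hx⟩ := exists_bisecting E
    fun a j => MvPolynomial.eval a (MvPolynomial.monomial (u j) 1)
  let P : MvPolynomial (Fin n) ℝ := ∑ j, MvPolynomial.monomial (u j) (x j)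
  have hcoeff : ∀ j, MvPolynomial.coeff (u j) P = x j := fun j => by
    simp [P, MvPolynomial.coeff_sum, MvPolynomial.coeff_monomial, u.injective.eq_iff,
      -Fintype.sum_option]
  have heval : ∀ a, MvPolynomial.eval a P =
      ∑ j, MvPolynomial.eval a (MvPolynomial.monomial (u j) 1) * x j := fun a => by
    simp [P, MvPolynomial.eval_monomial, mul_comm]
  refine ⟨P, fun hP => hx0 ?_, ?_, fun i => ?_⟩
  · ext j
    rw [← hcoeff j, hP, MvPolynomial.coeff_zero, Pi.zero_apply]
  · refine MvPolynomial.totalDegree_finsetSum_le fun j _ => ?_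
    exact (MvPolynomial.totalDegree_monomial_le _ _).trans (hu j)
  · simp only [heval, Finset.mem_coe]
    rw [← Finset.coe_filter, ← Finset.coe_filter, Set.ncard_coe_finset, Set.ncard_coe_finset]
    exact hx i
end
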